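/- Replacing the context-sensitive ∀ production rule σ_π^i (z₀ ⋆ z₁) y⃗ → (σ_{π₀}^i z₁ y⃗)[α ↦ z₀] of the proof grammar G_π by the context-free rule σ_π^i z y⃗ → (σ_{π₀}^i (p₁ z) y⃗)[α ↦ p₀ z] using pair projections p₀, p₁ yields a context-free grammar G'_π whose language contains L(G_π), and the language of G'_π is still finite (the increase over L(G_π) is at most finite). -/

import Mathlib

set_option maxHeartbeats 1000000

namespace PGram

/-! ### First-order terms and formulas -/

/-- First-order terms: variables, function symbols and application. -/
inductive Term : Type
  | var (n : ℕ)
  | fn (k : ℕ)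
  | app (s t : Term)
deriving DecidableEq

instance : Inhabited Term := ⟨.fn 0⟩

/-- Substitution of the variable `v` by the term `t`. -/
def Term.subst (v : ℕ) (t : Term) : Term → Term
  | .var n => if n = v then t else .var n
  | .fn k => .fn k
  | .app s u => .app (Term.subst v t s) (Term.subst v t u)

/-- Renaming of variables. -/
def Term.ren (ρ : ℕ → ℕ) : Term → Term
  | .var n => .var (ρ n)
  | .fn k => .fn k
  | .app s u => .app (Term.ren ρ s) (Term.ren ρ u)

def Term.vars : Term → List ℕ
  | .var n => [n]
  | .fn _ => []
  | .app s u => s.vars ++ u.vars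

/-- Formulas of first-order logic in negation normal form (one-sided calculus). -/
inductive Formula : Type
  | atom (pos : Bool) (P : ℕ) (ts : List Term)
  | or (A B : Formula)
  | and (A B : Formula)
  | all (v : ℕ) (A : Formula)
  | ex (v : ℕ) (A : Formula)

instance : Inhabited Formula := ⟨.atom true 0 []⟩

/-- The de Morgan dual `Ā` of a formula `A`. -/
def Formula.dual : Formula → Formula
  | .atom b P ts => .atom (!b) P ts
  | .or A B => .and A.dual B.dual
  | .and A B => .or A.dual B.dual
  | .all v A => .ex v A.dual
  | .ex v A => .all v A.dual

/-- Substitution `A(v/t)`. -/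
def Formula.subst (v : ℕ) (t : Term) : Formula → Formula
  | .atom b P ts => .atom b P (ts.map (Term.subst v t))
  | .or A B => .or (Formula.subst v t A) (Formula.subst v t B)
  | .and A B => .and (Formula.subst v t A) (Formula.subst v t B)
  | .all w A => if w = v then .all w A else .all w (Formula.subst v t A)
  | .ex w A => if w = v then .ex w A else .ex w (Formula.subst v t A)

/-- Renaming of all variables of a formula. -/
def Formula.ren (ρ : ℕ → ℕ) : Formula → Formula
  | .atom b P ts => .atom b P (ts.map (Term.ren ρ))
  | .or A B => .or (Formula.ren ρ A) (Formula.ren ρ B)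
  | .and A B => .and (Formula.ren ρ A) (Formula.ren ρ B)
  | .all v A => .all (ρ v) (Formula.ren ρ A)
  | .ex v A => .ex (ρ v) (Formula.ren ρ A)

/-- Free variables of a formula. -/
def Formula.fv : Formula → List ℕ
  | .atom _ _ ts => (ts.map Term.vars).foldr (· ++ ·) []
  | .or A B => A.fv ++ B.fv
  | .and A B => A.fv ++ B.fv
  | .all v A => A.fv.erase v
  | .ex v A => A.fv.erase v

/-- Quantifier-freeness. -/
def Formula.qfB : Formula → Bool
  | .atom .. => true
  | .or A B => A.qfB && B.qfB
  | .and A B => A.qfB && B.qfB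
  | .all .. => false
  | .ex .. => false

/-- `∃ v₀ ⋯ ∃ vₖ F`. -/
def Formula.exs (vs : List ℕ) (F : Formula) : Formula := vs.foldr .ex F

/-- `∀ v₀ ⋯ ∀ vₖ F`. -/
def Formula.alls (vs : List ℕ) (F : Formula) : Formula := vs.foldr .all F

/-- Simultaneous (iterated) substitution of the variables `vs` by the terms `ts`. -/
def Formula.substList (vs : List ℕ) (ts : List Term) (F : Formula) : Formula :=
  (vs.zip ts).foldl (fun A p => A.subst p.1 p.2) F

/-- Propositional (truth-functional) evaluation of a quantifier-free formula
under a valuation of the atoms. -/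
def Formula.evalQ (val : ℕ → List Term → Bool) : Formula → Bool
  | .atom b P ts => if b then val P ts else !(val P ts)
  | .or A B => Formula.evalQ val A || Formula.evalQ val B
  | .and A B => Formula.evalQ val A && Formula.evalQ val B
  | .all _ A => Formula.evalQ val A
  | .ex _ A => Formula.evalQ val A

/-- Number of universal quantifiers in the (prenex) quantifier prefix. -/
def Formula.prefAll : Formula → ℕ
  | .all _ A => A.prefAll + 1
  | .ex _ A => A.prefAll
  | _ => 0

/-- Number of existential quantifiers in the (prenex) quantifier prefix. -/
def Formula.prefEx : Formula → ℕ
  | .ex _ A => A.prefEx + 1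
  | .all _ A => A.prefEx
  | _ => 0

/-- Length of the leading block of universal quantifiers. -/
def Formula.allPre : Formula → ℕ
  | .all _ A => A.allPre + 1
  | _ => 0

/-- Length of the leading block of existential quantifiers. -/
def Formula.exPre : Formula → ℕ
  | .ex _ A => A.exPre + 1
  | _ => 0

def Formula.headAll : Formula → Bool
  | .all .. => true
  | _ => false

def Formula.headEx : Formula → Bool
  | .ex .. => true
  | _ => false

/-- Prenex Σ₁ formulas. -/
inductive Sigma1 : Formula → Prop
  | qf {A} : A.qfB = true → Sigma1 A
  | ex {v A} : Sigma1 A → Sigma1 (.ex v A)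

/-- Prenex Π₁ formulas. -/
inductive Pi1 : Formula → Prop
  | qf {A} : A.qfB = true → Pi1 A
  | all {v A} : Pi1 A → Pi1 (.all v A)

/-- Prenex Π₂ formulas. -/
inductive Pi2 : Formula → Prop
  | sig {A} : Sigma1 A → Pi2 A
  | all {v A} : Pi2 A → Pi2 (.all v A)

/-- Prenex Σ₂ formulas. -/
inductive Sigma2 : Formula → Prop
  | pi {A} : Pi1 A → Sigma2 A
  | ex {v A} : Sigma2 A → Sigma2 (.ex v A)

/-- Genuine prenex Π₂ formulas (not already Σ₂, i.e. with a ∀ properly before an ∃). -/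
def GenuinePi2 (F : Formula) : Prop := Pi2 F ∧ ¬ Sigma2 F

/-- Universally quantified Π₂ formulas. -/
def UnivPi2 (F : Formula) : Prop := Pi2 F ∧ F.headAll = true

end PGram
namespace PGram

/-! ### The one-sided sequent calculus LK -/

/-- Sequents: finite sequences of formulas. -/
abbrev Sequent := List Formula

/-- One-sided (Tait-style) sequent calculus LK with explicit weakening,
contraction and (adjacent) permutation. -/
inductive LK : Sequent → Type
  | ax (b : Bool) (P : ℕ) (ts : List Term) : LK [.atom b P ts, .atom (!b) P ts]
  | orI (A B : Formula) (Γ : Sequent) : LK (A :: B :: Γ) → LK (.or A B :: Γ)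
  | andI (A B : Formula) (Γ Δ : Sequent) : LK (A :: Γ) → LK (B :: Δ) → LK (.and A B :: (Γ ++ Δ))
  | allI (v α : ℕ) (A : Formula) (Γ : Sequent) :
      LK (A.subst v (.var α) :: Γ) → LK (.all v A :: Γ)
  | exI (v : ℕ) (t : Term) (A : Formula) (Γ : Sequent) :
      LK (A.subst v t :: Γ) → LK (.ex v A :: Γ)
  | cut (A : Formula) (Γ Δ : Sequent) : LK (A :: Γ) → LK (A.dual :: Δ) → LK (Γ ++ Δ)
  | wk (A : Formula) (Γ : Sequent) : LK Γ → LK (A :: Γ)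
  | ctr (A : Formula) (Γ : Sequent) : LK (A :: A :: Γ) → LK (A :: Γ)
  | perm (A B : Formula) (Γ Δ : Sequent) : LK (Γ ++ B :: A :: Δ) → LK (Γ ++ A :: B :: Δ)

/-- A proof together with its end sequent. -/
def PProof : Type := Σ Γ : Sequent, LK Γ

/-- Transport of a proof along an equality of sequents. -/
def LK.castSeq {Γ Δ : Sequent} (h : Γ = Δ) (p : LK Γ) : LK Δ := h ▸ p

/-- Moving a formula leftwards across a block `Λ` (a sequence of permutations). -/
def LK.hoist (A : Formula) (Λ : Sequent) :
    ∀ (Ξ Θ : Sequent), LK (Ξ ++ (Λ ++ A :: Θ)) → LK (Ξ ++ A :: (Λ ++ Θ)) :=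
  List.reverseRecOn
    (motive := fun Λ => ∀ (Ξ Θ : Sequent), LK (Ξ ++ (Λ ++ A :: Θ)) → LK (Ξ ++ A :: (Λ ++ Θ)))
    Λ (fun _ _ p => p)
    (fun Λ' C ih Ξ Θ p =>
      LK.castSeq (by simp)
        (ih Ξ (C :: Θ) (LK.castSeq (by simp) (LK.perm A C (Ξ ++ Λ') Θ (LK.castSeq (by simp) p)))))

/-- Moving a formula rightwards across a block `Λ` (a sequence of permutations). -/
def LK.plunge (A : Formula) : ∀ (Λ Ξ Θ : Sequent), LK (Ξ ++ A :: (Λ ++ Θ)) → LK (Ξ ++ (Λ ++ A :: Θ))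
  | [], _, _, p => p
  | C :: Λ', Ξ, Θ, p =>
      LK.castSeq (by simp)
        (LK.plunge A Λ' (Ξ ++ [C]) Θ (LK.castSeq (by simp) (LK.perm C A Ξ (Λ' ++ Θ) p)))

/-- Pull a formula to the front of the sequent. -/
def LK.pull (A : Formula) (Λ : Sequent) {Θ : Sequent} (p : LK (Λ ++ A :: Θ)) :
    LK (A :: (Λ ++ Θ)) :=
  LK.hoist A Λ [] Θ p

/-- Push the front formula into the sequent. -/
def LK.push (A : Formula) (Λ : Sequent) {Θ : Sequent} (p : LK (A :: (Λ ++ Θ))) :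
    LK (Λ ++ A :: Θ) :=
  LK.plunge A Λ [] Θ p

/-- Bring the last formula to the front. -/
def LK.toFront (A : Formula) (Γ : Sequent) (p : LK (Γ ++ [A])) : LK (A :: Γ) :=
  LK.castSeq (by simp) (LK.pull A Γ (Θ := []) p)

/-- Bring the front formula to the end. -/
def LK.toEnd (A : Formula) (Γ : Sequent) (p : LK (A :: Γ)) : LK (Γ ++ [A]) :=
  LK.push A Γ (Θ := []) (LK.castSeq (by simp) p)

/-- Exchange two blocks (a sequence of permutations). -/
def LK.swapBlk : ∀ (Δ Γ Λ : Sequent), LK (Γ ++ (Λ ++ Δ)) → LK (Γ ++ (Δ ++ Λ))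
  | [], Γ, Λ, p => LK.castSeq (by simp) p
  | B :: Δ', Γ, Λ, p =>
      LK.castSeq (by simp)
        (LK.swapBlk Δ' (Γ ++ [B]) Λ (LK.castSeq (by simp) (LK.hoist B Λ Γ Δ' p)))

/-- Contract a duplicated block `Δ` (the rule `c*`). -/
def LK.ctrBlock : ∀ (Δ Γ : Sequent), LK (Γ ++ (Δ ++ Δ)) → LK (Γ ++ Δ)
  | [], Γ, p => LK.castSeq (by simp) p
  | B :: Δ', Γ, p =>
      let p1 : LK (B :: (Γ ++ (Δ' ++ B :: Δ'))) := LK.pull B Γ (Θ := Δ' ++ B :: Δ') p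
      let p2 : LK ((B :: (Γ ++ Δ')) ++ B :: Δ') := LK.castSeq (by simp) p1
      let p3 : LK (B :: ((B :: (Γ ++ Δ')) ++ Δ')) := LK.pull B (B :: (Γ ++ Δ')) (Θ := Δ') p2
      let p4 : LK (B :: ((Γ ++ Δ') ++ Δ')) := LK.ctr B ((Γ ++ Δ') ++ Δ') p3
      let p5 : LK ((B :: Γ) ++ (Δ' ++ Δ')) := LK.castSeq (by simp) p4
      let p6 : LK ((B :: Γ) ++ Δ') := LK.ctrBlock Δ' (B :: Γ) p5
      LK.push B Γ (Θ := Δ') p6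

/-- Weakening by a whole sequent `Δ` (the rule `w*`). -/
def LK.wkEnd : ∀ (Δ : Sequent) {Γ : Sequent}, LK Γ → LK (Γ ++ Δ)
  | [], _, p => LK.castSeq (by simp) p
  | B :: Δ', Γ, p => LK.castSeq (by simp) (LK.wkEnd Δ' (LK.toEnd B Γ (LK.wk B Γ p)))

/-- The eigenvariables of the strong quantifier inferences of a proof. -/
def LK.eigenVars : {Γ : Sequent} → LK Γ → List ℕ
  | _, .ax .. => []
  | _, .orI _ _ _ p => p.eigenVars
  | _, .andI _ _ _ _ p q => p.eigenVars ++ q.eigenVars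
  | _, .allI _ α _ _ p => α :: p.eigenVars
  | _, .exI _ _ _ _ p => p.eigenVars
  | _, .cut _ _ _ p q => p.eigenVars ++ q.eigenVars
  | _, .wk _ _ p => p.eigenVars
  | _, .ctr _ _ p => p.eigenVars
  | _, .perm _ _ _ _ p => p.eigenVars

/-- The cut formulas occurring in a proof. -/
def LK.cutFormulas : {Γ : Sequent} → LK Γ → List Formula
  | _, .ax .. => []
  | _, .orI _ _ _ p => p.cutFormulas
  | _, .andI _ _ _ _ p q => p.cutFormulas ++ q.cutFormulas
  | _, .allI _ _ _ _ p => p.cutFormulas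
  | _, .exI _ _ _ _ p => p.cutFormulas
  | _, .cut A _ _ p q => A :: (p.cutFormulas ++ q.cutFormulas)
  | _, .wk _ _ p => p.cutFormulas
  | _, .ctr _ _ p => p.cutFormulas
  | _, .perm _ _ _ _ p => p.cutFormulas

/-- Cut-freeness of a proof. -/
def LK.CutFree {Γ : Sequent} (p : LK Γ) : Prop := p.cutFormulas = []

/-- All cut formulas are prenex Ξ₂ or Σ₂. -/
def LK.CutsPi2Sigma2 {Γ : Sequent} (p : LK Γ) : Prop :=
  ∀ A ∈ p.cutFormulas, Pi2 A ∨ Sigma2 A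

/-- No contraction inference on the formula `C` occurs in the proof. -/
def LK.noCtrOn (C : Formula) : {Γ : Sequent} → LK Γ → Prop
  | _, .ax .. => True
  | _, .orI _ _ _ p => p.noCtrOn C
  | _, .andI _ _ _ _ p q => p.noCtrOn C ∧ q.noCtrOn C
  | _, .allI _ _ _ _ p => p.noCtrOn C
  | _, .exI _ _ _ _ p => p.noCtrOn C
  | _, .cut _ _ _ p q => p.noCtrOn C ∧ q.noCtrOn C
  | _, .wk _ _ p => p.noCtrOn C
  | _, .ctr A _ p => A ≠ C ∧ p.noCtrOn C
  | _, .perm _ _ _ _ p => p.noCtrOn C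

/-- Free variables of a sequent. -/
def seqFv (Γ : Sequent) : List ℕ := (Γ.map Formula.fv).foldr (· ++ ·) []

/-- Regularity: each strong quantifier inference has a unique eigenvariable,
and eigenvariables satisfy the eigenvariable condition. -/
def LK.Regular : {Γ : Sequent} → LK Γ → Prop
  | _, .ax .. => True
  | _, .orI _ _ _ p => p.Regular
  | _, .andI _ _ _ _ p q => p.Regular ∧ q.Regular ∧ p.eigenVars.Disjoint q.eigenVars
  | _, .allI v α A Γ p => α ∉ seqFv (.all v A :: Γ) ∧ α ∉ p.eigenVars ∧ p.Regular
  | _, .exI _ _ _ _ p => p.Regular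
  | _, .cut _ _ _ p q => p.Regular ∧ q.Regular ∧ p.eigenVars.Disjoint q.eigenVars
  | _, .wk _ _ p => p.Regular
  | _, .ctr _ _ p => p.Regular
  | _, .perm _ _ _ _ p => p.Regular

end PGram
namespace PGram

/-! ### The proof grammar -/

/-- Structured λ-terms of the proof grammar: de Bruijn bound variables, free
variables (eigenvariables), first-order function symbols, the empty sequence
`⟨⟩`, application, abstraction, pairing `⋆`, explicit substitution `s[α ↦ t]`,
non-terminals `σ_π^i`, and pair projections (for the context-free variant). -/
inductive GTerm : Type
  | bvar (n : ℕ)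
  | fvar (n : ℕ)
  | fn (k : ℕ)
  | unit
  | app (s t : GTerm)
  | lam (s : GTerm)
  | pair (s t : GTerm)
  | esub (s : GTerm) (α : ℕ) (t : GTerm)
  | nt (p : PProof) (i : ℕ)
  | pr0 (s : GTerm)
  | pr1 (s : GTerm)

/-- Iterated application. -/
def GTerm.apps (h : GTerm) (l : List GTerm) : GTerm := l.foldl GTerm.app h

/-- Embedding of first-order terms into grammar terms. -/
def Term.toG : Term → GTerm
  | .var n => .fvar n
  | .fn k => .fn k
  | .app s t => .app s.toG t.toG

/-- de Bruijn shifting. -/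
def GTerm.shift (d : ℕ) : ℕ → GTerm → GTerm
  | k, .bvar n => if n < k then .bvar n else .bvar (n + d)
  | _, .fvar n => .fvar n
  | _, .fn m => .fn m
  | _, .unit => .unit
  | k, .app s t => .app (GTerm.shift d k s) (GTerm.shift d k t)
  | k, .lam s => .lam (GTerm.shift d (k + 1) s)
  | k, .pair s t => .pair (GTerm.shift d k s) (GTerm.shift d k t)
  | k, .esub s α t => .esub (GTerm.shift d k s) α (GTerm.shift d k t)
  | _, .nt p i => .nt p i
  | k, .pr0 s => .pr0 (GTerm.shift d k s)
  | k, .pr1 s => .pr1 (GTerm.shift d k s)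

/-- de Bruijn instantiation (β-substitution of bound variable `k` by `u`). -/
def GTerm.instB (u : GTerm) : ℕ → GTerm → GTerm
  | k, .bvar n => if n = k then GTerm.shift k 0 u else if k < n then .bvar (n - 1) else .bvar n
  | _, .fvar n => .fvar n
  | _, .fn m => .fn m
  | _, .unit => .unit
  | k, .app s t => .app (GTerm.instB u k s) (GTerm.instB u k t)
  | k, .lam s => .lam (GTerm.instB u (k + 1) s)
  | k, .pair s t => .pair (GTerm.instB u k s) (GTerm.instB u k t)
  | k, .esub s α t => .esub (GTerm.instB u k s) α (GTerm.instB u k t)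
  | _, .nt p i => .nt p i
  | k, .pr0 s => .pr0 (GTerm.instB u k s)
  | k, .pr1 s => .pr1 (GTerm.instB u k s)

/-- Substitution of the free variable `α` by `u`. -/
def GTerm.substF (α : ℕ) (u : GTerm) : GTerm → GTerm
  | .bvar n => .bvar n
  | .fvar n => if n = α then u else .fvar n
  | .fn m => .fn m
  | .unit => .unit
  | .app s t => .app (GTerm.substF α u s) (GTerm.substF α u t)
  | .lam s => .lam (GTerm.substF α u s)
  | .pair s t => .pair (GTerm.substF α u s) (GTerm.substF α u t)
  | .esub s β t => .esub (GTerm.substF α u s) β (GTerm.substF α u t)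
  | .nt p i => .nt p i
  | .pr0 s => .pr0 (GTerm.substF α u s)
  | .pr1 s => .pr1 (GTerm.substF α u s)

/-- Evaluation `T ↦ T*` of all explicit substitutions. -/
def GTerm.evalE : GTerm → GTerm
  | .bvar n => .bvar n
  | .fvar n => .fvar n
  | .fn m => .fn m
  | .unit => .unit
  | .app s t => .app s.evalE t.evalE
  | .lam s => .lam s.evalE
  | .pair s t => .pair s.evalE t.evalE
  | .esub s α t => GTerm.substF α t.evalE s.evalE
  | .nt p i => .nt p i
  | .pr0 s => .pr0 s.evalE
  | .pr1 s => .pr1 s.evalE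

/-- Reading back a (non-terminal free, substitution free) grammar term as a
first-order term. -/
def GTerm.toFOT : GTerm → Option Term
  | .fvar n => some (.var n)
  | .fn k => some (.fn k)
  | .app s t => do
      let s' ← s.toFOT
      let t' ← t.toFOT
      pure (.app s' t')
  | _ => none

/-- Reading back a sequence-term `⟨t₁,…,tₖ⟩` as a list of first-order terms. -/
def GTerm.toSeq : GTerm → Option (List Term)
  | .unit => some []
  | .pair s t => do
      let s' ← s.toFOT
      let t' ← t.toSeq
      pure (s' :: t')
  | _ => none

/-- `m`-fold λ-abstraction. -/
def GTerm.lams : ℕ → GTerm → GTerm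
  | 0, b => b
  | m + 1, b => .lam (GTerm.lams m b)

/-- The sequence-term `⟨z₀,…,z_{m-1}⟩` of the bound variables of `m` enclosing
abstractions. -/
def GTerm.varSeq (m : ℕ) : GTerm :=
  (List.range m).reverse.foldr (fun j acc => .pair (.bvar j) acc) .unit

/-- The sequence-term `⟨c,…,c⟩` (`k` copies) of a fixed constant, written `c_A`. -/
def GTerm.constSeq (k : ℕ) : GTerm :=
  (List.range k).foldr (fun _ acc => .pair (.fn 0) acc) .unit

/-- The composition operation `(σ_p⁰ ∘_F σ_q⁰) x̄ ȳ` of the cut production rules. -/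
def comp (F : Formula) (p q : PProof) (xs ys : List GTerm) : GTerm :=
  if F.qfB then .unit
  else if F.headAll then
    .lams F.allPre
      (GTerm.apps (.nt p 0) (GTerm.varSeq F.allPre :: xs.map (GTerm.shift F.allPre 0)))
  else
    GTerm.apps (.nt p 0)
      ((GTerm.lams F.exPre
          (GTerm.apps (.nt q 0) (GTerm.varSeq F.exPre :: ys.map (GTerm.shift F.exPre 0)))) :: xs)

/-- One-step rewriting of the proof grammar: production rules (determined by
the last inference of the indexing proof), β-reduction and congruence closure.
The parameter `cf` selects the context-free variant of the `∀`-production rule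
(via pair projections). -/
inductive Step (cf : Bool) : GTerm → GTerm → Prop
  -- β-reduction and computation rules
  | beta (s t : GTerm) : Step cf (.app (.lam s) t) (GTerm.instB t 0 s)
  | unitApp (t : GTerm) : Step cf (.app .unit t) .unit
  | proj0 (s t : GTerm) : Step cf (.pr0 (.pair s t)) s
  | proj1 (s t : GTerm) : Step cf (.pr1 (.pair s t)) t
  -- congruence closure
  | appL {s s'} (t : GTerm) : Step cf s s' → Step cf (.app s t) (.app s' t)
  | appR (s : GTerm) {t t'} : Step cf t t' → Step cf (.app s t) (.app s t')
  | lamC {s s'} : Step cf s s' → Step cf (.lam s) (.lam s')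
  | pairL {s s'} (t : GTerm) : Step cf s s' → Step cf (.pair s t) (.pair s' t)
  | pairR (s : GTerm) {t t'} : Step cf t t' → Step cf (.pair s t) (.pair s t')
  | esubL {s s'} (α : ℕ) (t : GTerm) : Step cf s s' → Step cf (.esub s α t) (.esub s' α t)
  | esubR (s : GTerm) (α : ℕ) {t t'} : Step cf t t' → Step cf (.esub s α t) (.esub s α t')
  | pr0C {s s'} : Step cf s s' → Step cf (.pr0 s) (.pr0 s')
  | pr1C {s s'} : Step cf s s' → Step cf (.pr1 s) (.pr1 s')
  -- production rules (cf. Table 2)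
  | ax0 (b P ts) (z₀ z₁ : GTerm) :
      Step cf (GTerm.apps (.nt ⟨_, LK.ax b P ts⟩ 0) [z₀, z₁]) z₁
  | ax1 (b P ts) (z₀ z₁ : GTerm) :
      Step cf (GTerm.apps (.nt ⟨_, LK.ax b P ts⟩ 1) [z₀, z₁]) z₀
  | orI0 {A B Γ} (p : LK (A :: B :: Γ)) (z : GTerm) (ys : List GTerm)
      (hy : ys.length = Γ.length) :
      Step cf (GTerm.apps (.nt ⟨_, LK.orI A B Γ p⟩ 0) (z :: ys)) .unit
  | orIS {A B Γ} (p : LK (A :: B :: Γ)) (i : ℕ) (z : GTerm) (ys : List GTerm)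
      (hy : ys.length = Γ.length) :
      Step cf (GTerm.apps (.nt ⟨_, LK.orI A B Γ p⟩ (i + 1)) (z :: ys))
        (GTerm.apps (.nt ⟨_, p⟩ (i + 2)) (.unit :: .unit :: ys))
  | andI0 {A B Γ Δ} (p : LK (A :: Γ)) (q : LK (B :: Δ)) (z : GTerm) (xs ys : List GTerm)
      (hx : xs.length = Γ.length) (hy : ys.length = Δ.length) :
      Step cf (GTerm.apps (.nt ⟨_, LK.andI A B Γ Δ p q⟩ 0) (z :: (xs ++ ys))) .unit
  | andIL {A B Γ Δ} (p : LK (A :: Γ)) (q : LK (B :: Δ)) (i : ℕ) (z : GTerm)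
      (xs ys : List GTerm) (hx : xs.length = Γ.length) (hy : ys.length = Δ.length)
      (hi : i < Γ.length) :
      Step cf (GTerm.apps (.nt ⟨_, LK.andI A B Γ Δ p q⟩ (i + 1)) (z :: (xs ++ ys)))
        (GTerm.apps (.nt ⟨_, p⟩ (i + 1)) (.unit :: xs))
  | andIR {A B Γ Δ} (p : LK (A :: Γ)) (q : LK (B :: Δ)) (i : ℕ) (z : GTerm)
      (xs ys : List GTerm) (hx : xs.length = Γ.length) (hy : ys.length = Δ.length)
      (hi : Γ.length ≤ i) :
      Step cf (GTerm.apps (.nt ⟨_, LK.andI A B Γ Δ p q⟩ (i + 1)) (z :: (xs ++ ys)))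
        (GTerm.apps (.nt ⟨_, q⟩ (i - Γ.length + 1)) (.unit :: ys))
  | allP {v α A Γ} (p : LK (A.subst v (.var α) :: Γ)) (i : ℕ) (z₀ z₁ : GTerm)
      (ys : List GTerm) (hy : ys.length = Γ.length) (hcf : cf = false) :
      Step cf (GTerm.apps (.nt ⟨_, LK.allI v α A Γ p⟩ i) (.pair z₀ z₁ :: ys))
        (.esub (GTerm.apps (.nt ⟨_, p⟩ i) (z₁ :: ys)) α z₀)
  | allPcf {v α A Γ} (p : LK (A.subst v (.var α) :: Γ)) (i : ℕ) (z : GTerm)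
      (ys : List GTerm) (hy : ys.length = Γ.length) (hcf : cf = true) :
      Step cf (GTerm.apps (.nt ⟨_, LK.allI v α A Γ p⟩ i) (z :: ys))
        (.esub (GTerm.apps (.nt ⟨_, p⟩ i) (.pr1 z :: ys)) α (.pr0 z))
  | exI0 {v t A Γ} (p : LK (A.subst v t :: Γ)) (z : GTerm) (ys : List GTerm)
      (hy : ys.length = Γ.length) :
      Step cf (GTerm.apps (.nt ⟨_, LK.exI v t A Γ p⟩ 0) (z :: ys))
        (.pair t.toG (GTerm.apps (.nt ⟨_, p⟩ 0) (.app z t.toG :: ys)))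
  | exIS {v t A Γ} (p : LK (A.subst v t :: Γ)) (i : ℕ) (z : GTerm) (ys : List GTerm)
      (hy : ys.length = Γ.length) :
      Step cf (GTerm.apps (.nt ⟨_, LK.exI v t A Γ p⟩ (i + 1)) (z :: ys))
        (GTerm.apps (.nt ⟨_, p⟩ (i + 1)) (.app z t.toG :: ys))
  | cutL {A Γ Δ} (p : LK (A :: Γ)) (q : LK (A.dual :: Δ)) (i : ℕ) (xs ys : List GTerm)
      (hx : xs.length = Γ.length) (hy : ys.length = Δ.length) (hi : i < Γ.length) :
      Step cf (GTerm.apps (.nt ⟨_, LK.cut A Γ Δ p q⟩ i) (xs ++ ys))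
        (GTerm.apps (.nt ⟨_, p⟩ (i + 1)) (comp A.dual ⟨_, q⟩ ⟨_, p⟩ ys xs :: xs))
  | cutR {A Γ Δ} (p : LK (A :: Γ)) (q : LK (A.dual :: Δ)) (i : ℕ) (xs ys : List GTerm)
      (hx : xs.length = Γ.length) (hy : ys.length = Δ.length) (hi : Γ.length ≤ i) :
      Step cf (GTerm.apps (.nt ⟨_, LK.cut A Γ Δ p q⟩ i) (xs ++ ys))
        (GTerm.apps (.nt ⟨_, q⟩ (i - Γ.length + 1)) (comp A ⟨_, p⟩ ⟨_, q⟩ xs ys :: ys))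
  | ctr0a {A Γ} (p : LK (A :: A :: Γ)) (z : GTerm) (ys : List GTerm)
      (hy : ys.length = Γ.length) :
      Step cf (GTerm.apps (.nt ⟨_, LK.ctr A Γ p⟩ 0) (z :: ys))
        (GTerm.apps (.nt ⟨_, p⟩ 0) (z :: z :: ys))
  | ctr0b {A Γ} (p : LK (A :: A :: Γ)) (z : GTerm) (ys : List GTerm)
      (hy : ys.length = Γ.length) :
      Step cf (GTerm.apps (.nt ⟨_, LK.ctr A Γ p⟩ 0) (z :: ys))
        (GTerm.apps (.nt ⟨_, p⟩ 1) (z :: z :: ys))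
  | ctrS {A Γ} (p : LK (A :: A :: Γ)) (i : ℕ) (z : GTerm) (ys : List GTerm)
      (hy : ys.length = Γ.length) :
      Step cf (GTerm.apps (.nt ⟨_, LK.ctr A Γ p⟩ (i + 1)) (z :: ys))
        (GTerm.apps (.nt ⟨_, p⟩ (i + 2)) (z :: z :: ys))
  | wk0 {A Γ} (p : LK Γ) (z : GTerm) (ys : List GTerm) (hy : ys.length = Γ.length) :
      Step cf (GTerm.apps (.nt ⟨_, LK.wk A Γ p⟩ 0) (z :: ys)) (GTerm.constSeq A.prefEx)
  | wkS {A Γ} (p : LK Γ) (i : ℕ) (z : GTerm) (ys : List GTerm)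
      (hy : ys.length = Γ.length) :
      Step cf (GTerm.apps (.nt ⟨_, LK.wk A Γ p⟩ (i + 1)) (z :: ys))
        (GTerm.apps (.nt ⟨_, p⟩ i) ys)
  | permP {A B Γ Δ} (p : LK (Γ ++ B :: A :: Δ)) (i : ℕ) (xs : List GTerm)
      (z₀ z₁ : GTerm) (ys : List GTerm) (hx : xs.length = Γ.length)
      (hy : ys.length = Δ.length) :
      Step cf (GTerm.apps (.nt ⟨_, LK.perm A B Γ Δ p⟩ i) (xs ++ z₀ :: z₁ :: ys))
        (GTerm.apps
          (.nt ⟨_, p⟩ (if i = Γ.length then i + 1 else if i = Γ.length + 1 then i - 1 else i))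
          (xs ++ z₁ :: z₀ :: ys))

/-- Normal forms of the grammar rewriting relation. -/
def NormalForm (cf : Bool) (u : GTerm) : Prop := ∀ v, ¬ Step cf u v

/-- The language of a grammar term: the set of terms derivable from it to
which no further rules apply. -/
def LangT (cf : Bool) (u : GTerm) : Set GTerm :=
  {v | Relation.ReflTransGen (Step cf) u v ∧ NormalForm cf v}

/-- The start term `σ_π^i ⟨⟩ ⋯ ⟨⟩`. -/
def startTerm (p : PProof) (i : ℕ) : GTerm :=
  GTerm.apps (.nt p i) (List.replicate p.1.length .unit)

/-- The language `L(π)` of the proof grammar `G_π`: all pairs `(i, T*)` of an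
end-sequent index and the evaluated tuple of first-order witness terms of a
non-terminal-free sequence-term `T` derivable from `σ_π^i ⟨⟩ ⋯ ⟨⟩`. -/
def LangP (cf : Bool) (p : PProof) : Set (ℕ × List Term) :=
  {x | x.1 < p.1.length ∧ ∃ T ∈ LangT cf (startTerm p x.1), T.evalE.toSeq = some x.2}

/-- The language of the proof grammar `G_π`. -/
def L (p : PProof) : Set (ℕ × List Term) := LangP false p

/-- The language of the context-free variant `G'_π` of the proof grammar. -/
def L' (p : PProof) : Set (ℕ × List Term) := LangP true p

end PGram
namespace PGram

/-! ### Herbrand sets -/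

/-- The Herbrand set of a proof of a prenex Σ₁ sequent: the set of pairs
`(i, t̄)` of instance tuples of the existential quantifier block of the `i`-th
end-sequent formula, as the witnesses appear in the proof. -/
def LK.herbrand : {Γ : Sequent} → LK Γ → Set (ℕ × List Term)
  | _, .ax .. => {x | (x.1 = 0 ∨ x.1 = 1) ∧ x.2 = []}
  | _, .orI _ _ _ p =>
      {x | (x.1 = 0 ∧ x.2 = []) ∨ (0 < x.1 ∧ (x.1 + 1, x.2) ∈ p.herbrand)}
  | _, .andI _ _ Γ _ p q =>
      {x | (x.1 = 0 ∧ x.2 = []) ∨ (0 < x.1 ∧ x.1 ≤ Γ.length ∧ (x.1, x.2) ∈ p.herbrand) ∨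
        (Γ.length < x.1 ∧ (x.1 - Γ.length, x.2) ∈ q.herbrand)}
  | _, .allI _ _ _ _ p => p.herbrand
  | _, .exI _ t _ _ p =>
      {x | (x.1 = 0 ∧ ∃ ts, x.2 = t :: ts ∧ (0, ts) ∈ p.herbrand) ∨
        (0 < x.1 ∧ (x.1, x.2) ∈ p.herbrand)}
  | _, .cut _ Γ _ p q =>
      {x | (x.1 < Γ.length ∧ (x.1 + 1, x.2) ∈ p.herbrand) ∨
        (Γ.length ≤ x.1 ∧ (x.1 - Γ.length + 1, x.2) ∈ q.herbrand)}
  | _, .wk _ _ p => {x | 0 < x.1 ∧ (x.1 - 1, x.2) ∈ p.herbrand}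
  | _, .ctr _ _ p =>
      {x | (x.1 = 0 ∧ ((0, x.2) ∈ p.herbrand ∨ (1, x.2) ∈ p.herbrand)) ∨
        (0 < x.1 ∧ (x.1 + 1, x.2) ∈ p.herbrand)}
  | _, .perm _ _ Γ _ p =>
      {x | (x.1 = Γ.length ∧ (x.1 + 1, x.2) ∈ p.herbrand) ∨
        (x.1 = Γ.length + 1 ∧ (x.1 - 1, x.2) ∈ p.herbrand) ∨
        (x.1 ≠ Γ.length ∧ x.1 ≠ Γ.length + 1 ∧ (x.1, x.2) ∈ p.herbrand)}

/-! ### Substitution and renaming of proofs -/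

/-- `VSub α t π π'` expresses that `π'` is the result `π[α ↦ t]` of replacing
the (eigen)variable `α` by the term `t` throughout the proof `π`. -/
inductive VSub (α : ℕ) (t : Term) : {Γ Δ : Sequent} → LK Γ → LK Δ → Prop
  | ax (b P ts) : VSub α t (.ax b P ts) (.ax b P (ts.map (Term.subst α t)))
  | orI {A B Γ A' B' Γ'} (p : LK (A :: B :: Γ)) (p' : LK (A' :: B' :: Γ'))
      (hA : A' = A.subst α t) (hB : B' = B.subst α t)
      (hΓ : Γ' = Γ.map (Formula.subst α t)) (h : VSub α t p p') :
      VSub α t (.orI A B Γ p) (.orI A' B' Γ' p')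
  | andI {A B Γ Δ A' B' Γ' Δ'} (p : LK (A :: Γ)) (q : LK (B :: Δ))
      (p' : LK (A' :: Γ')) (q' : LK (B' :: Δ'))
      (hA : A' = A.subst α t) (hB : B' = B.subst α t)
      (hΓ : Γ' = Γ.map (Formula.subst α t)) (hΔ : Δ' = Δ.map (Formula.subst α t))
      (hp : VSub α t p p') (hq : VSub α t q q') :
      VSub α t (.andI A B Γ Δ p q) (.andI A' B' Γ' Δ' p' q')
  | allI {v β A Γ A' Γ'} (p : LK (A.subst v (.var β) :: Γ))
      (p' : LK (A'.subst v (.var β) :: Γ')) (hβ : β ≠ α)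
      (hA : A' = A.subst α t) (hΓ : Γ' = Γ.map (Formula.subst α t))
      (h : VSub α t p p') : VSub α t (.allI v β A Γ p) (.allI v β A' Γ' p')
  | exI {v r A Γ A' Γ'} (p : LK (A.subst v r :: Γ))
      (p' : LK (A'.subst v (r.subst α t) :: Γ'))
      (hA : A' = A.subst α t) (hΓ : Γ' = Γ.map (Formula.subst α t))
      (h : VSub α t p p') : VSub α t (.exI v r A Γ p) (.exI v (r.subst α t) A' Γ' p')
  | cut {A Γ Δ A' Γ' Δ'} (p : LK (A :: Γ)) (q : LK (A.dual :: Δ))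
      (p' : LK (A' :: Γ')) (q' : LK (A'.dual :: Δ'))
      (hA : A' = A.subst α t) (hΓ : Γ' = Γ.map (Formula.subst α t))
      (hΔ : Δ' = Δ.map (Formula.subst α t))
      (hp : VSub α t p p') (hq : VSub α t q q') :
      VSub α t (.cut A Γ Δ p q) (.cut A' Γ' Δ' p' q')
  | wk {A Γ A' Γ'} (p : LK Γ) (p' : LK Γ')
      (hA : A' = A.subst α t) (hΓ : Γ' = Γ.map (Formula.subst α t))
      (h : VSub α t p p') : VSub α t (.wk A Γ p) (.wk A' Γ' p')
  | ctr {A Γ A' Γ'} (p : LK (A :: A :: Γ)) (p' : LK (A' :: A' :: Γ'))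
      (hA : A' = A.subst α t) (hΓ : Γ' = Γ.map (Formula.subst α t))
      (h : VSub α t p p') : VSub α t (.ctr A Γ p) (.ctr A' Γ' p')
  | perm {A B Γ Δ A' B' Γ' Δ'} (p : LK (Γ ++ B :: A :: Δ)) (p' : LK (Γ' ++ B' :: A' :: Δ'))
      (hA : A' = A.subst α t) (hB : B' = B.subst α t)
      (hΓ : Γ' = Γ.map (Formula.subst α t)) (hΔ : Δ' = Δ.map (Formula.subst α t))
      (h : VSub α t p p') : VSub α t (.perm A B Γ Δ p) (.perm A' B' Γ' Δ' p')

/-- `Ren ρ π π'` expresses that `π'` is the result of renaming all variables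
of `π` (in particular its eigenvariables) along `ρ`. -/
inductive Ren (ρ : ℕ → ℕ) : {Γ Δ : Sequent} → LK Γ → LK Δ → Prop
  | ax (b P ts) : Ren ρ (.ax b P ts) (.ax b P (ts.map (Term.ren ρ)))
  | orI {A B Γ A' B' Γ'} (p : LK (A :: B :: Γ)) (p' : LK (A' :: B' :: Γ'))
      (hA : A' = A.ren ρ) (hB : B' = B.ren ρ) (hΓ : Γ' = Γ.map (Formula.ren ρ))
      (h : Ren ρ p p') : Ren ρ (.orI A B Γ p) (.orI A' B' Γ' p')
  | andI {A B Γ Δ A' B' Γ' Δ'} (p : LK (A :: Γ)) (q : LK (B :: Δ))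
      (p' : LK (A' :: Γ')) (q' : LK (B' :: Δ'))
      (hA : A' = A.ren ρ) (hB : B' = B.ren ρ)
      (hΓ : Γ' = Γ.map (Formula.ren ρ)) (hΔ : Δ' = Δ.map (Formula.ren ρ))
      (hp : Ren ρ p p') (hq : Ren ρ q q') :
      Ren ρ (.andI A B Γ Δ p q) (.andI A' B' Γ' Δ' p' q')
  | allI {v β A Γ v' β' A' Γ'} (p : LK (A.subst v (.var β) :: Γ))
      (p' : LK (A'.subst v' (.var β') :: Γ'))
      (hv : v' = ρ v) (hβ : β' = ρ β) (hA : A' = A.ren ρ)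
      (hΓ : Γ' = Γ.map (Formula.ren ρ)) (h : Ren ρ p p') :
      Ren ρ (.allI v β A Γ p) (.allI v' β' A' Γ' p')
  | exI {v r A Γ v' A' Γ'} (p : LK (A.subst v r :: Γ))
      (p' : LK (A'.subst v' (r.ren ρ) :: Γ'))
      (hv : v' = ρ v) (hA : A' = A.ren ρ) (hΓ : Γ' = Γ.map (Formula.ren ρ))
      (h : Ren ρ p p') : Ren ρ (.exI v r A Γ p) (.exI v' (r.ren ρ) A' Γ' p')
  | cut {A Γ Δ A' Γ' Δ'} (p : LK (A :: Γ)) (q : LK (A.dual :: Δ))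
      (p' : LK (A' :: Γ')) (q' : LK (A'.dual :: Δ'))
      (hA : A' = A.ren ρ) (hΓ : Γ' = Γ.map (Formula.ren ρ)) (hΔ : Δ' = Δ.map (Formula.ren ρ))
      (hp : Ren ρ p p') (hq : Ren ρ q q') :
      Ren ρ (.cut A Γ Δ p q) (.cut A' Γ' Δ' p' q')
  | wk {A Γ A' Γ'} (p : LK Γ) (p' : LK Γ')
      (hA : A' = A.ren ρ) (hΓ : Γ' = Γ.map (Formula.ren ρ)) (h : Ren ρ p p') :
      Ren ρ (.wk A Γ p) (.wk A' Γ' p')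
  | ctr {A Γ A' Γ'} (p : LK (A :: A :: Γ)) (p' : LK (A' :: A' :: Γ'))
      (hA : A' = A.ren ρ) (hΓ : Γ' = Γ.map (Formula.ren ρ)) (h : Ren ρ p p') :
      Ren ρ (.ctr A Γ p) (.ctr A' Γ' p')
  | perm {A B Γ Δ A' B' Γ' Δ'} (p : LK (Γ ++ B :: A :: Δ)) (p' : LK (Γ' ++ B' :: A' :: Δ'))
      (hA : A' = A.ren ρ) (hB : B' = B.ren ρ)
      (hΓ : Γ' = Γ.map (Formula.ren ρ)) (hΔ : Δ' = Δ.map (Formula.ren ρ))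
      (h : Ren ρ p p') : Ren ρ (.perm A B Γ Δ p) (.perm A' B' Γ' Δ' p')

/-- `π'` is a fresh (eigenvariable-renamed) copy of `π` with the same end
sequent. -/
def FreshCopy (p q : PProof) : Prop := p.1 = q.1 ∧ ∃ ρ : ℕ → ℕ, Ren ρ p.2 q.2

end PGram
namespace PGram

/-! ### Gentzen-style cut reduction steps (Figure 1) -/

/-- Axiom reduction, redex: a cut of `π₀ ⊢ Γ, A` against the axiom `Ā, A`. -/
def axRedex {b : Bool} {P : ℕ} {ts : List Term} {Γ : Sequent}
    (π₀ : LK (Γ ++ [Formula.atom b P ts])) : PProof :=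
  ⟨Γ ++ [Formula.atom b P ts],
    .cut (.atom b P ts) Γ [.atom b P ts] (LK.toFront _ Γ π₀)
      (LK.castSeq (by simp [Formula.dual]) (.ax (!b) P ts))⟩

/-- Boolean reduction, redex. -/
def boolRedex {A B : Formula} {Γ Δ Λ : Sequent} (π₀ : LK (A :: Γ)) (π₁ : LK (B :: Δ))
    (π₂ : LK (A.dual :: B.dual :: Λ)) : PProof :=
  ⟨(Γ ++ Δ) ++ Λ,
    .cut (.and A B) (Γ ++ Δ) Λ (.andI A B Γ Δ π₀ π₁) (.orI A.dual B.dual Λ π₂)⟩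

/-- Boolean reduction, reduct. -/
def boolReduct {A B : Formula} {Γ Δ Λ : Sequent} (π₀ : LK (A :: Γ)) (π₁ : LK (B :: Δ))
    (π₂ : LK (A.dual :: B.dual :: Λ)) : PProof :=
  ⟨(Γ ++ Δ) ++ Λ,
    LK.castSeq (by simp)
      (.cut A Γ (Δ ++ Λ) π₀
        (LK.pull A.dual Δ (.cut B Δ (A.dual :: Λ) π₁ (.perm B.dual A.dual [] Λ π₂))))⟩

/-- Quantifier reduction, redex: a cut on `∀v A` between a `∀`-inference with
eigenvariable `α` and an `∃`-inference with witness `t`. -/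
def quantRedex {v α : ℕ} {A : Formula} {Γ Δ : Sequent} {t : Term}
    (π₀ : LK (A.subst v (.var α) :: Γ)) (π₁ : LK (A.dual.subst v t :: Δ)) : PProof :=
  ⟨Γ ++ Δ, .cut (.all v A) Γ Δ (.allI v α A Γ π₀) (.exI v t A.dual Δ π₁)⟩

/-- Quantifier reduction, reduct: the cut on `A(v/t)`. -/
def quantReduct {B : Formula} {Γ Δ : Sequent} (π₀' : LK (B :: Γ))
    (π₁' : LK (B.dual :: Δ)) : PProof :=
  ⟨Γ ++ Δ, .cut B Γ Δ π₀' π₁'⟩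

/-- Weakening reduction, redex. -/
def wkRedex {A : Formula} {Γ Δ : Sequent} (π₀ : LK Γ) (π₁ : LK (A.dual :: Δ)) : PProof :=
  ⟨Γ ++ Δ, .cut A Γ Δ (.wk A Γ π₀) π₁⟩

/-- Weakening reduction, reduct: `π₀` followed by weakenings introducing `Δ`. -/
def wkReduct {Γ : Sequent} (Δ : Sequent) (π₀ : LK Γ) : PProof :=
  ⟨Γ ++ Δ, LK.wkEnd Δ π₀⟩

/-- Contraction reduction, redex: a cut on `F` against a contraction on `F`. -/
def ctrRedex {F : Formula} {Γ Δ : Sequent} (π₀ : LK (F :: F :: Γ))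
    (π₁ : LK (F.dual :: Δ)) : PProof :=
  ⟨Γ ++ Δ, .cut F Γ Δ (.ctr F Γ π₀) π₁⟩

/-- Contraction reduction, reduct: two successive cuts (against `π₁` and a
fresh copy `π₁'` of it) followed by contractions `c*` of the duplicated
context `Δ`. -/
def ctrReduct {F : Formula} {Γ Δ : Sequent} (π₀ : LK (F :: F :: Γ))
    (π₁ π₁' : LK (F.dual :: Δ)) : PProof :=
  ⟨Γ ++ Δ,
    LK.ctrBlock Δ Γ
      (LK.castSeq (by simp) (.cut F (Γ ++ Δ) Δ (.cut F (F :: Γ) Δ π₀ π₁) π₁'))⟩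

/-- Permutation of two cuts (on `F` and on `G`), the un-permuted proof. -/
def cutPerm1 {F G : Formula} {Γ Δ Λ : Sequent} (π₀ : LK (F :: G :: Γ))
    (π₁ : LK (F.dual :: Δ)) (π₂ : LK (G.dual :: Λ)) : PProof :=
  ⟨(Γ ++ Δ) ++ Λ, .cut G (Γ ++ Δ) Λ (.cut F (G :: Γ) Δ π₀ π₁) π₂⟩

/-- Permutation of two cuts (on `F` and on `G`), the permuted proof. -/
def cutPerm2 {F G : Formula} {Γ Δ Λ : Sequent} (π₀ : LK (F :: G :: Γ))
    (π₁ : LK (F.dual :: Δ)) (π₂ : LK (G.dual :: Λ)) : PProof :=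
  ⟨(Γ ++ Δ) ++ Λ,
    LK.castSeq (by simp)
      (LK.swapBlk Δ Γ Λ
        (LK.castSeq (by simp)
          (.cut F (Γ ++ Λ) Δ (.cut G (F :: Γ) Λ (.perm G F [] Γ π₀) π₂) π₁)))⟩

/-- Root axiom reduction step. -/
inductive RAx : PProof → PProof → Prop
  | mk {b : Bool} {P : ℕ} {ts : List Term} {Γ : Sequent}
      (π₀ : LK (Γ ++ [Formula.atom b P ts])) : RAx (axRedex π₀) ⟨_, π₀⟩

/-- Root boolean reduction step. -/
inductive RBool : PProof → PProof → Prop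
  | mk {A B : Formula} {Γ Δ Λ : Sequent} (π₀ : LK (A :: Γ)) (π₁ : LK (B :: Δ))
      (π₂ : LK (A.dual :: B.dual :: Λ)) :
      RBool (boolRedex π₀ π₁ π₂) (boolReduct π₀ π₁ π₂)

/-- Root quantifier reduction step. -/
inductive RQuant : PProof → PProof → Prop
  | mk {v α : ℕ} {A B : Formula} {Γ Δ : Sequent} {t : Term}
      (π₀ : LK (A.subst v (.var α) :: Γ)) (π₁ : LK (A.dual.subst v t :: Δ))
      (π₀' : LK (B :: Γ)) (π₁' : LK (B.dual :: Δ)) (hB : B = A.subst v t)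
      (hs : VSub α t π₀ π₀') (hπ : HEq π₁ π₁') :
      RQuant (quantRedex π₀ π₁) (quantReduct π₀' π₁')

/-- Root weakening reduction step. -/
inductive RWk : PProof → PProof → Prop
  | mk {A : Formula} {Γ Δ : Sequent} (π₀ : LK Γ) (π₁ : LK (A.dual :: Δ)) :
      RWk (wkRedex (A := A) π₀ π₁) (wkReduct Δ π₀)

/-- Root contraction reduction step on the cut formula `F`. -/
inductive RCtr (F : Formula) : PProof → PProof → Prop
  | mk {Γ Δ : Sequent} (π₀ : LK (F :: F :: Γ)) (π₁ π₁' : LK (F.dual :: Δ))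
      (hfresh : FreshCopy ⟨_, π₁⟩ ⟨_, π₁'⟩) :
      RCtr F (ctrRedex π₀ π₁) (ctrReduct π₀ π₁ π₁')

/-- Root permutation of a unary inference below a cut. -/
inductive RUn : PProof → PProof → Prop
  | orP {A B F : Formula} {Ξ₁ Ξ₂ Δ : Sequent} (π₀ : LK (A :: B :: (Ξ₁ ++ F :: Ξ₂)))
      (π₁ : LK (F.dual :: Δ)) :
      RUn ⟨_, .cut F (.or A B :: (Ξ₁ ++ Ξ₂)) Δ
              (LK.pull F (.or A B :: Ξ₁) (.orI A B (Ξ₁ ++ F :: Ξ₂) π₀)) π₁⟩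
          ⟨_, .orI A B ((Ξ₁ ++ Ξ₂) ++ Δ)
              (.cut F (A :: B :: (Ξ₁ ++ Ξ₂)) Δ (LK.pull F (A :: B :: Ξ₁) π₀) π₁)⟩
  | allP {v β : ℕ} {A F : Formula} {Ξ₁ Ξ₂ Δ : Sequent}
      (π₀ : LK (A.subst v (.var β) :: (Ξ₁ ++ F :: Ξ₂))) (π₁ : LK (F.dual :: Δ)) :
      RUn ⟨_, .cut F (.all v A :: (Ξ₁ ++ Ξ₂)) Δ
              (LK.pull F (.all v A :: Ξ₁) (.allI v β A (Ξ₁ ++ F :: Ξ₂) π₀)) π₁⟩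
          ⟨_, .allI v β A ((Ξ₁ ++ Ξ₂) ++ Δ)
              (.cut F (A.subst v (.var β) :: (Ξ₁ ++ Ξ₂)) Δ
                (LK.pull F (A.subst v (.var β) :: Ξ₁) π₀) π₁)⟩
  | exP {v : ℕ} {t : Term} {A F : Formula} {Ξ₁ Ξ₂ Δ : Sequent}
      (π₀ : LK (A.subst v t :: (Ξ₁ ++ F :: Ξ₂))) (π₁ : LK (F.dual :: Δ)) :
      RUn ⟨_, .cut F (.ex v A :: (Ξ₁ ++ Ξ₂)) Δ
              (LK.pull F (.ex v A :: Ξ₁) (.exI v t A (Ξ₁ ++ F :: Ξ₂) π₀)) π₁⟩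
          ⟨_, .exI v t A ((Ξ₁ ++ Ξ₂) ++ Δ)
              (.cut F (A.subst v t :: (Ξ₁ ++ Ξ₂)) Δ
                (LK.pull F (A.subst v t :: Ξ₁) π₀) π₁)⟩
  | wkP {B F : Formula} {Ξ₁ Ξ₂ Δ : Sequent} (π₀ : LK (Ξ₁ ++ F :: Ξ₂))
      (π₁ : LK (F.dual :: Δ)) :
      RUn ⟨_, .cut F (B :: (Ξ₁ ++ Ξ₂)) Δ
              (LK.pull F (B :: Ξ₁) (.wk B (Ξ₁ ++ F :: Ξ₂) π₀)) π₁⟩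
          ⟨_, .wk B ((Ξ₁ ++ Ξ₂) ++ Δ)
              (.cut F (Ξ₁ ++ Ξ₂) Δ (LK.pull F Ξ₁ π₀) π₁)⟩
  | ctrP {B F : Formula} {Ξ₁ Ξ₂ Δ : Sequent} (π₀ : LK (B :: B :: (Ξ₁ ++ F :: Ξ₂)))
      (π₁ : LK (F.dual :: Δ)) :
      RUn ⟨_, .cut F (B :: (Ξ₁ ++ Ξ₂)) Δ
              (LK.pull F (B :: Ξ₁) (.ctr B (Ξ₁ ++ F :: Ξ₂) π₀)) π₁⟩
          ⟨_, .ctr B ((Ξ₁ ++ Ξ₂) ++ Δ)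
              (.cut F (B :: B :: (Ξ₁ ++ Ξ₂)) Δ (LK.pull F (B :: B :: Ξ₁) π₀) π₁)⟩
  | permP {C D F : Formula} {Λ Θ Δ : Sequent} (π₀ : LK (F :: (Λ ++ D :: C :: Θ)))
      (π₁ : LK (F.dual :: Δ)) :
      RUn ⟨_, .cut F (Λ ++ C :: D :: Θ) Δ (.perm C D (F :: Λ) Θ π₀) π₁⟩
          ⟨(Λ ++ C :: D :: Θ) ++ Δ, LK.castSeq (by simp)
              (.perm C D Λ (Θ ++ Δ)
                (LK.castSeq (by simp) (.cut F (Λ ++ D :: C :: Θ) Δ π₀ π₁)))⟩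

/-- Root permutation of a binary inference (here `∧`) below a cut, the cut
attaching to the right premise. -/
inductive RBin : PProof → PProof → Prop
  | andR {A B F : Formula} {Γ Ξ₁ Ξ₂ Δ : Sequent} (π₀ : LK (A :: Γ))
      (π₁ : LK (B :: (Ξ₁ ++ F :: Ξ₂))) (π₂ : LK (F.dual :: Δ)) :
      RBin ⟨_, .cut F (.and A B :: ((Γ ++ Ξ₁) ++ Ξ₂)) Δ
              (LK.pull F (.and A B :: (Γ ++ Ξ₁))
                (LK.castSeq (by simp) (.andI A B Γ (Ξ₁ ++ F :: Ξ₂) π₀ π₁))) π₂⟩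
           ⟨(Formula.and A B :: ((Γ ++ Ξ₁) ++ Ξ₂)) ++ Δ, LK.castSeq (by simp)
              (.andI A B Γ ((Ξ₁ ++ Ξ₂) ++ Δ) π₀
                (.cut F (B :: (Ξ₁ ++ Ξ₂)) Δ (LK.pull F (B :: Ξ₁) π₁) π₂))⟩

/-- Root permutation of two cuts, on the cut formulas `F` and `G`. -/
inductive RCut (F G : Formula) : PProof → PProof → Prop
  | mk {Γ Δ Λ : Sequent} (π₀ : LK (F :: G :: Γ)) (π₁ : LK (F.dual :: Δ))
      (π₂ : LK (G.dual :: Λ)) : RCut F G (cutPerm1 π₀ π₁ π₂) (cutPerm2 π₀ π₁ π₂)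

/-- Any root reduction or permutation step of Figure 1. -/
def RedRoot (p q : PProof) : Prop :=
  RAx p q ∨ RBool p q ∨ RQuant p q ∨ RWk p q ∨ (∃ F, RCtr F p q) ∨ RUn p q ∨ RBin p q ∨
    ∃ F G, RCut F G p q

/-- Closure of a root relation under all inference-rule contexts: `Clo R`
applies `R` to an arbitrary sub-proof. -/
inductive Clo (R : PProof → PProof → Prop) : PProof → PProof → Prop
  | base {p q : PProof} : R p q → Clo R p q
  | orC {A B Γ} {p q : LK (A :: B :: Γ)} :
      Clo R ⟨_, p⟩ ⟨_, q⟩ → Clo R ⟨_, LK.orI A B Γ p⟩ ⟨_, LK.orI A B Γ q⟩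
  | andL {A B Γ Δ} {p q : LK (A :: Γ)} (r : LK (B :: Δ)) :
      Clo R ⟨_, p⟩ ⟨_, q⟩ → Clo R ⟨_, LK.andI A B Γ Δ p r⟩ ⟨_, LK.andI A B Γ Δ q r⟩
  | andR {A B Γ Δ} (r : LK (A :: Γ)) {p q : LK (B :: Δ)} :
      Clo R ⟨_, p⟩ ⟨_, q⟩ → Clo R ⟨_, LK.andI A B Γ Δ r p⟩ ⟨_, LK.andI A B Γ Δ r q⟩
  | allC {v α A Γ} {p q : LK (A.subst v (.var α) :: Γ)} :
      Clo R ⟨_, p⟩ ⟨_, q⟩ → Clo R ⟨_, LK.allI v α A Γ p⟩ ⟨_, LK.allI v α A Γ q⟩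
  | exC {v t A Γ} {p q : LK (A.subst v t :: Γ)} :
      Clo R ⟨_, p⟩ ⟨_, q⟩ → Clo R ⟨_, LK.exI v t A Γ p⟩ ⟨_, LK.exI v t A Γ q⟩
  | cutL {A Γ Δ} {p q : LK (A :: Γ)} (r : LK (A.dual :: Δ)) :
      Clo R ⟨_, p⟩ ⟨_, q⟩ → Clo R ⟨_, LK.cut A Γ Δ p r⟩ ⟨_, LK.cut A Γ Δ q r⟩
  | cutR {A Γ Δ} (r : LK (A :: Γ)) {p q : LK (A.dual :: Δ)} :
      Clo R ⟨_, p⟩ ⟨_, q⟩ → Clo R ⟨_, LK.cut A Γ Δ r p⟩ ⟨_, LK.cut A Γ Δ r q⟩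
  | wkC {A Γ} {p q : LK Γ} :
      Clo R ⟨_, p⟩ ⟨_, q⟩ → Clo R ⟨_, LK.wk A Γ p⟩ ⟨_, LK.wk A Γ q⟩
  | ctrC {A Γ} {p q : LK (A :: A :: Γ)} :
      Clo R ⟨_, p⟩ ⟨_, q⟩ → Clo R ⟨_, LK.ctr A Γ p⟩ ⟨_, LK.ctr A Γ q⟩
  | permC {A B Γ Δ} {p q : LK (Γ ++ B :: A :: Δ)} :
      Clo R ⟨_, p⟩ ⟨_, q⟩ → Clo R ⟨_, LK.perm A B Γ Δ p⟩ ⟨_, LK.perm A B Γ Δ q⟩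

/-- The one-step Gentzen cut-reduction relation (Figure 1), applied to an
arbitrary sub-proof. -/
def Red : PProof → PProof → Prop := Clo RedRoot

/-- Root reduction steps other than contraction reduction and cut-cut
permutation. -/
def OtherRoot (p r : PProof) : Prop :=
  RAx p r ∨ RBool p r ∨ RQuant p r ∨ RWk p r ∨ RUn p r ∨ RBin p r

/-- Root steps of the strategy of Theorem 1(1)-(2): a contraction on a
universally quantified Π₂ cut formula is reduced only when no other reduction
rule is applicable to this cut, and two cuts are permuted only when not both
cut formulas are Π₂. -/
def Strat1Root (p q : PProof) : Prop :=
  OtherRoot p q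
    ∨ (∃ F, RCtr F p q ∧ (UnivPi2 F → ∀ r, ¬ (OtherRoot p r ∨ ∃ F' G', RCut F' G' p r)))
    ∨ (∃ F G, RCut F G p q ∧ ¬ (Pi2 F ∧ Pi2 G))

/-- Root steps of the weak-side-first strategy: a step acting on the strong
(universal) side of a cut on a genuine Π₂ cut formula — a contraction
reduction, or a permutation of two Π₂ cuts — is taken only when no reduction
acting on the weak side is applicable to this cut. -/
def WeakFirstRoot (p q : PProof) : Prop :=
  OtherRoot p q
    ∨ (∃ F, RCtr F p q ∧ (UnivPi2 F → ∀ r, ¬ OtherRoot p r))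
    ∨ (∃ F G, RCut F G p q ∧ ((Pi2 F ∧ Pi2 G) → ∀ r, ¬ OtherRoot p r))

/-! ### Sub-proofs, non-terminal occurrences, types -/

/-- Immediate sub-proof. -/
inductive ImSub : PProof → PProof → Prop
  | orI {A B Γ} (p : LK (A :: B :: Γ)) : ImSub ⟨_, p⟩ ⟨_, LK.orI A B Γ p⟩
  | andL {A B Γ Δ} (p : LK (A :: Γ)) (q : LK (B :: Δ)) : ImSub ⟨_, p⟩ ⟨_, LK.andI A B Γ Δ p q⟩
  | andR {A B Γ Δ} (p : LK (A :: Γ)) (q : LK (B :: Δ)) : ImSub ⟨_, q⟩ ⟨_, LK.andI A B Γ Δ p q⟩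
  | allI {v α A Γ} (p : LK (A.subst v (.var α) :: Γ)) : ImSub ⟨_, p⟩ ⟨_, LK.allI v α A Γ p⟩
  | exI {v t A Γ} (p : LK (A.subst v t :: Γ)) : ImSub ⟨_, p⟩ ⟨_, LK.exI v t A Γ p⟩
  | cutL {A Γ Δ} (p : LK (A :: Γ)) (q : LK (A.dual :: Δ)) : ImSub ⟨_, p⟩ ⟨_, LK.cut A Γ Δ p q⟩
  | cutR {A Γ Δ} (p : LK (A :: Γ)) (q : LK (A.dual :: Δ)) : ImSub ⟨_, q⟩ ⟨_, LK.cut A Γ Δ p q⟩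
  | wk {A Γ} (p : LK Γ) : ImSub ⟨_, p⟩ ⟨_, LK.wk A Γ p⟩
  | ctr {A Γ} (p : LK (A :: A :: Γ)) : ImSub ⟨_, p⟩ ⟨_, LK.ctr A Γ p⟩
  | perm {A B Γ Δ} (p : LK (Γ ++ B :: A :: Δ)) : ImSub ⟨_, p⟩ ⟨_, LK.perm A B Γ Δ p⟩

/-- Strict sub-proof. -/
def StrictSub : PProof → PProof → Prop := Relation.TransGen ImSub

/-- The proofs indexing the non-terminals occurring in a grammar term. -/
def GTerm.nts : GTerm → List PProof
  | .bvar _ => []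
  | .fvar _ => []
  | .fn _ => []
  | .unit => []
  | .app s t => s.nts ++ t.nts
  | .lam s => s.nts
  | .pair s t => s.nts ++ t.nts
  | .esub s _ t => s.nts ++ t.nts
  | .nt p _ => [p]
  | .pr0 s => s.nts
  | .pr1 s => s.nts

/-- Types of the proof grammar: ground types `o` (structured first-order
terms) and `ε` (unit), pair types and function types. -/
inductive GType : Type
  | o
  | eps
  | prod (ρ σ : GType)
  | arr (ρ σ : GType)

/-- The order of a type. -/
def GType.ord : GType → ℕ
  | .o => 0
  | .eps => 0
  | .prod ρ σ => max ρ.ord σ.ord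
  | .arr ρ σ => max (ρ.ord + 1) σ.ord

/-- `o^n`. -/
def GType.opow : ℕ → GType
  | 0 => .eps
  | n + 1 => .prod .o (GType.opow n)

/-- `o → ⋯ → o → τ` with `m` arguments. -/
def GType.arrows : ℕ → GType → GType
  | 0, τ => τ
  | m + 1, τ => .arr .o (GType.arrows m τ)

/-- The output type `τ_F` of a prenex formula `F`. -/
def tauF (F : Formula) : GType := .opow F.prefEx

/-- The argument type `τ*_F` of a prenex formula `F`. -/
def taustarF (F : Formula) : GType :=
  if F.headEx = true ∧ 0 < F.prefAll then .arrows F.prefEx (.opow F.prefAll)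
  else .opow F.prefAll

/-- The type `τ*_{A₀} → ⋯ → τ*_{Aₙ} → τ_{Aᵢ}` of the non-terminal `σ_π^i`
for `π ⊢ Γ = A₀,…,Aₙ`. -/
def ntType (Γ : Sequent) (i : ℕ) : GType :=
  (Γ.map taustarF).foldr .arr (tauF (Γ.getD i default))

end PGram

namespace PGram

/-! ### An over-approximation of the context-free grammar -/

/-- A finite list containing all right-hand sides of the context-free production rules
for `σ_p^i` applied to `args`. -/
def prods : {Γ : Sequent} → LK Γ → ℕ → List GTerm → List GTerm
  | _, .ax .., _, args => [args.getD 1 .unit, args.getD 0 .unit]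
  | _, .orI _ _ _ p, i, args =>
      [.unit, GTerm.apps (.nt ⟨_, p⟩ (i + 1)) (.unit :: .unit :: args.tail)]
  | _, .andI _ _ Γ _ p q, i, args =>
      [.unit, GTerm.apps (.nt ⟨_, p⟩ i) (.unit :: args.tail.take Γ.length),
        GTerm.apps (.nt ⟨_, q⟩ (i - 1 - Γ.length + 1)) (.unit :: args.tail.drop Γ.length)]
  | _, .allI _ α _ _ p, i, args =>
      [.esub (GTerm.apps (.nt ⟨_, p⟩ i) (.pr1 (args.getD 0 .unit) :: args.tail)) α
        (.pr0 (args.getD 0 .unit))]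
  | _, .exI _ t _ _ p, i, args =>
      [.pair t.toG (GTerm.apps (.nt ⟨_, p⟩ i) (.app (args.getD 0 .unit) t.toG :: args.tail)),
        GTerm.apps (.nt ⟨_, p⟩ i) (.app (args.getD 0 .unit) t.toG :: args.tail)]
  | _, .cut A Γ _ p q, i, args =>
      [GTerm.apps (.nt ⟨_, p⟩ (i + 1))
          (comp A.dual ⟨_, q⟩ ⟨_, p⟩ (args.drop Γ.length) (args.take Γ.length) ::
            args.take Γ.length),
        GTerm.apps (.nt ⟨_, q⟩ (i - Γ.length + 1))
          (comp A ⟨_, p⟩ ⟨_, q⟩ (args.take Γ.length) (args.drop Γ.length) ::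
            args.drop Γ.length)]
  | _, .wk A _ p, i, args =>
      [GTerm.constSeq A.prefEx, GTerm.apps (.nt ⟨_, p⟩ (i - 1)) args.tail]
  | _, .ctr _ _ p, i, args =>
      [GTerm.apps (.nt ⟨_, p⟩ i) (args.getD 0 .unit :: args.getD 0 .unit :: args.tail),
        GTerm.apps (.nt ⟨_, p⟩ (i + 1)) (args.getD 0 .unit :: args.getD 0 .unit :: args.tail)]
  | _, .perm _ _ Γ _ p, i, args =>
      [GTerm.apps
        (.nt ⟨_, p⟩ (if i = Γ.length then i + 1 else if i = Γ.length + 1 then i - 1 else i))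
        (args.take Γ.length ++ args.getD (Γ.length + 1) .unit :: args.getD Γ.length .unit ::
          args.drop (Γ.length + 2))]

/-- One-step rewriting with the production rules replaced by `prods`. -/
inductive Stp : GTerm → GTerm → Prop
  | beta (s t : GTerm) : Stp (.app (.lam s) t) (GTerm.instB t 0 s)
  | unitApp (t : GTerm) : Stp (.app .unit t) .unit
  | proj0 (s t : GTerm) : Stp (.pr0 (.pair s t)) s
  | proj1 (s t : GTerm) : Stp (.pr1 (.pair s t)) t
  | appL {s s'} (t : GTerm) : Stp s s' → Stp (.app s t) (.app s' t)
  | appR (s : GTerm) {t t'} : Stp t t' → Stp (.app s t) (.app s t')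
  | lamC {s s'} : Stp s s' → Stp (.lam s) (.lam s')
  | pairL {s s'} (t : GTerm) : Stp s s' → Stp (.pair s t) (.pair s' t)
  | pairR (s : GTerm) {t t'} : Stp t t' → Stp (.pair s t) (.pair s t')
  | esubL {s s'} (α : ℕ) (t : GTerm) : Stp s s' → Stp (.esub s α t) (.esub s' α t)
  | esubR (s : GTerm) (α : ℕ) {t t'} : Stp t t' → Stp (.esub s α t) (.esub s α t')
  | pr0C {s s'} : Stp s s' → Stp (.pr0 s) (.pr0 s')
  | pr1C {s s'} : Stp s s' → Stp (.pr1 s) (.pr1 s')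
  | prod {u v : GTerm} (P : PProof) (i : ℕ) (args : List GTerm)
      (hu : u = GTerm.apps (.nt P i) args) (hlen : args.length = P.1.length)
      (hv : v ∈ prods P.2 i args) : Stp u v

theorem Step.toStp {u v : GTerm} (h : Step true u v) : Stp u v := by
  induction h with
  | beta s t => exact .beta s t
  | unitApp t => exact .unitApp t
  | proj0 s t => exact .proj0 s t
  | proj1 s t => exact .proj1 s t
  | appL t _ ih => exact .appL t ih
  | appR s _ ih => exact .appR s ih
  | lamC _ ih => exact .lamC ih
  | pairL t _ ih => exact .pairL t ih
  | pairR s _ ih => exact .pairR s ih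
  | esubL α t _ ih => exact .esubL α t ih
  | esubR s α _ ih => exact .esubR s α ih
  | pr0C _ ih => exact .pr0C ih
  | pr1C _ ih => exact .pr1C ih
  | allP _ _ _ _ _ _ hcf => cases hcf
  | andIL p q i z xs ys hx hy hi =>
      refine .prod _ _ _ rfl (by simp [hx, hy]) ?_
      simp [prods, ← hx]
  | andIR p q i z xs ys hx hy hi =>
      refine .prod _ _ _ rfl (by simp [hx, hy]) ?_
      simp [prods, ← hx]
  | cutL p q i xs ys hx hy hi =>
      refine .prod _ _ _ rfl (by simp [hx, hy]) ?_
      simp [prods, ← hx]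
  | cutR p q i xs ys hx hy hi =>
      refine .prod _ _ _ rfl (by simp [hx, hy]) ?_
      simp [prods, ← hx]
  | permP p i xs z₀ z₁ ys hx hy =>
      refine .prod _ _ _ rfl (by simp [hx, hy]) ?_
      simp [prods, ← hx, List.getD_eq_getElem?_getD, List.drop_append,
        List.drop_of_length_le (show xs.length ≤ xs.length + 2 by omega)]
  | _ =>
      refine .prod _ _ _ rfl (by simp [*]) ?_
      simp [prods]

/-! ### Spines -/

/-- The head of an application spine. -/
def GTerm.spineHead : GTerm → GTerm
  | .app s _ => s.spineHead
  | s => s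

/-- The arguments of an application spine. -/
def GTerm.spineArgs : GTerm → List GTerm
  | .app s t => s.spineArgs ++ [t]
  | _ => []

theorem GTerm.apps_concat (h : GTerm) (l : List GTerm) (t : GTerm) :
    GTerm.apps h (l ++ [t]) = .app (GTerm.apps h l) t := by
  simp [GTerm.apps]

theorem GTerm.spineHead_apps (P : PProof) (i : ℕ) (l : List GTerm) :
    (GTerm.apps (.nt P i) l).spineHead = .nt P i := by
  induction l using List.reverseRecOn with
  | nil => rfl
  | append_singleton l t ih => rw [GTerm.apps_concat]; exact ih

theorem GTerm.spineArgs_apps (P : PProof) (i : ℕ) (l : List GTerm) :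
    (GTerm.apps (.nt P i) l).spineArgs = l := by
  induction l using List.reverseRecOn with
  | nil => rfl
  | append_singleton l t ih => rw [GTerm.apps_concat]; simp [GTerm.spineArgs, ih]

/-- A term headed by a non-terminal has all the arguments of that non-terminal. -/
def Sat (N : GTerm) : Prop :=
  ∀ P i, N.spineHead = .nt P i → P.1.length ≤ N.spineArgs.length

theorem Sat.app {s : GTerm} (h : Sat s) (t : GTerm) : Sat (.app s t) := by
  intro P i hP
  have := h P i hP
  simp [GTerm.spineArgs]; omega

theorem Stp.pair_inv {a b v : GTerm} (h : Stp (.pair a b) v) :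
    (∃ a', Stp a a' ∧ v = .pair a' b) ∨ ∃ b', Stp b b' ∧ v = .pair a b' := by
  cases h with
  | pairL _ h => exact .inl ⟨_, h, rfl⟩
  | pairR _ h => exact .inr ⟨_, h, rfl⟩
  | prod P i args hu => exact absurd (hu ▸ GTerm.spineHead_apps P i args) (by simp [GTerm.spineHead])

theorem Stp.esub_inv {a b v : GTerm} {α : ℕ} (h : Stp (.esub a α b) v) :
    (∃ a', Stp a a' ∧ v = .esub a' α b) ∨ ∃ b', Stp b b' ∧ v = .esub a α b' := by
  cases h with
  | esubL _ _ h => exact .inl ⟨_, h, rfl⟩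
  | esubR _ _ h => exact .inr ⟨_, h, rfl⟩
  | prod P i args hu => exact absurd (hu ▸ GTerm.spineHead_apps P i args) (by simp [GTerm.spineHead])

theorem Stp.pr0_inv {a v : GTerm} (h : Stp (.pr0 a) v) :
    (∃ a', Stp a a' ∧ v = .pr0 a') ∨ ∃ b, a = .pair v b := by
  cases h with
  | proj0 _ t => exact .inr ⟨t, rfl⟩
  | pr0C h => exact .inl ⟨_, h, rfl⟩
  | prod P i args hu => exact absurd (hu ▸ GTerm.spineHead_apps P i args) (by simp [GTerm.spineHead])

theorem Stp.pr1_inv {a v : GTerm} (h : Stp (.pr1 a) v) :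
    (∃ a', Stp a a' ∧ v = .pr1 a') ∨ ∃ b, a = .pair b v := by
  cases h with
  | proj1 s _ => exact .inr ⟨s, rfl⟩
  | pr1C h => exact .inl ⟨_, h, rfl⟩
  | prod P i args hu => exact absurd (hu ▸ GTerm.spineHead_apps P i args) (by simp [GTerm.spineHead])

theorem Stp.lam_inv {a v : GTerm} (h : Stp (.lam a) v) : ∃ a', Stp a a' ∧ v = .lam a' := by
  cases h with
  | lamC h => exact ⟨_, h, rfl⟩
  | prod P i args hu => exact absurd (hu ▸ GTerm.spineHead_apps P i args) (by simp [GTerm.spineHead])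

theorem Stp.app_inv {s t v : GTerm} (h : Stp (.app s t) v) :
    (∃ s', Stp s s' ∧ v = .app s' t) ∨ (∃ t', Stp t t' ∧ v = .app s t') ∨
      (∃ c, s = .lam c ∧ v = GTerm.instB t 0 c) ∨ (s = .unit ∧ v = .unit) ∨
      ∃ P i args, args.length + 1 = P.1.length ∧ s = GTerm.apps (.nt P i) args ∧
        v ∈ prods P.2 i (args ++ [t]) := by
  cases h with
  | beta c _ => exact .inr (.inr (.inl ⟨c, rfl, rfl⟩))
  | unitApp => exact .inr (.inr (.inr (.inl ⟨rfl, rfl⟩)))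
  | appL _ h => exact .inl ⟨_, h, rfl⟩
  | appR _ h => exact .inr (.inl ⟨_, h, rfl⟩)
  | prod P i args hu hlen hv =>
      refine .inr (.inr (.inr (.inr ⟨P, i, ?_⟩)))
      rcases List.eq_nil_or_concat args with rfl | ⟨l, a, rfl⟩
      · cases hu
      · rw [List.concat_eq_append, GTerm.apps_concat] at hu
        obtain ⟨rfl, rfl⟩ := GTerm.app.inj hu
        exact ⟨l, by simpa using hlen, rfl, by simpa using hv⟩

theorem Stp.app_inv_of_sat {s t v : GTerm} (h : Stp (.app s t) v) (hs : Sat s) :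
    (∃ s', Stp s s' ∧ v = .app s' t) ∨ (∃ t', Stp t t' ∧ v = .app s t') ∨
      (∃ c, s = .lam c ∧ v = GTerm.instB t 0 c) ∨ (s = .unit ∧ v = .unit) := by
  rcases h.app_inv with h | h | h | h | ⟨P, i, args, hl, rfl, -⟩
  · exact .inl h
  · exact .inr (.inl h)
  · exact .inr (.inr (.inl h))
  · exact .inr (.inr (.inr h))
  · have := hs P i (GTerm.spineHead_apps P i args)
    rw [GTerm.spineArgs_apps] at this
    omega

/-! ### Strong normalization -/

/-- Strong normalization. -/
def SN (s : GTerm) : Prop := Acc (fun b a => Stp a b) s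

theorem SN.step {s s' : GTerm} (h : SN s) (hs : Stp s s') : SN s' := Acc.inv h hs

theorem SN.of_steps {s : GTerm} (h : ∀ s', Stp s s' → SN s') : SN s := Acc.intro _ h

theorem SN.of_map (f : GTerm → GTerm) (hf : ∀ {s s'}, Stp s s' → Stp (f s) (f s')) {s : GTerm}
    (h : SN (f s)) : SN s :=
  Subrelation.accessible (fun h => hf h) (InvImage.accessible f h)

theorem SN.pr0 {s : GTerm} (h : SN s) : SN (.pr0 s) := by
  induction h with
  | intro s hs ih =>
    refine .of_steps fun v hv => ?_
    rcases hv.pr0_inv with ⟨a', ha, rfl⟩ | ⟨b, rfl⟩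
    · exact ih _ ha
    · exact SN.of_map (fun x => .pair x b) (fun h => .pairL b h) (Acc.intro _ hs)

theorem SN.pr1 {s : GTerm} (h : SN s) : SN (.pr1 s) := by
  induction h with
  | intro s hs ih =>
    refine .of_steps fun v hv => ?_
    rcases hv.pr1_inv with ⟨a', ha, rfl⟩ | ⟨b, rfl⟩
    · exact ih _ ha
    · exact SN.of_map (fun x => .pair b x) (fun h => .pairR b h) (Acc.intro _ hs)

/-- Terms obtained from `z` by projections `p₁` and applications to strongly normalizing
arguments. -/
inductive Elim (z : GTerm) : GTerm → Prop
  | refl : Elim z z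
  | pr1 {s} : Elim z s → Elim z (.pr1 s)
  | app {s t} : Elim z s → SN t → Elim z (.app s t)

/-- The reducibility predicate for ground types. -/
def W (z : GTerm) : Prop := ∀ s, Elim z s → SN s

theorem Elim.trans {a b c : GTerm} (h : Elim a b) (h' : Elim b c) : Elim a c := by
  induction h' with
  | refl => exact h
  | pr1 _ ih => exact .pr1 ih
  | app _ ht ih => exact .app ih ht

theorem W.sn {z : GTerm} (h : W z) : SN z := h z .refl

theorem W.pr1 {z : GTerm} (h : W z) : W (.pr1 z) := fun s hs => h s ((Elim.pr1 .refl).trans hs)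

theorem W.app {z t : GTerm} (h : W z) (ht : SN t) : W (.app z t) :=
  fun s hs => h s ((Elim.app .refl ht).trans hs)

theorem W.step {z z' : GTerm} (h : W z) (hz : Stp z z') : W z' := by
  intro s hs
  have : ∃ r, Elim z r ∧ Stp r s := by
    induction hs with
    | refl => exact ⟨z, .refl, hz⟩
    | pr1 _ ih =>
        obtain ⟨r, hr, hrs⟩ := ih
        exact ⟨_, hr.pr1, .pr1C hrs⟩
    | app _ ht ih =>
        obtain ⟨r, hr, hrs⟩ := ih
        exact ⟨_, hr.app ht, .appL _ hrs⟩
  obtain ⟨r, hr, hrs⟩ := this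
  exact (h r hr).step hrs

theorem Elim.sat {z s : GTerm} (h : Elim z s) (hz : Sat z) : Sat s := by
  induction h with
  | refl => exact hz
  | pr1 _ _ => intro P i h; simp [GTerm.spineHead] at h
  | app _ _ ih => exact ih.app _

theorem W.of_steps {N : GTerm} (hsat : Sat N) (hlam : ∀ c, N ≠ .lam c)
    (hpair : ∀ a b, N = .pair a b → W b) (hN : ∀ N', Stp N N' → W N') : W N := by
  have hNsn : SN N := .of_steps fun N' h => (hN N' h).sn
  have inv : ∀ s, Elim N s → ∀ s', Stp s s' → Elim N s' ∨ W s' := by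
    intro s hs
    induction hs with
    | refl => exact fun s' h => .inr (hN s' h)
    | @pr1 s hs ih =>
        intro v hv
        rcases hv.pr1_inv with ⟨a', ha, rfl⟩ | ⟨b, rfl⟩
        · exact (ih _ ha).imp Elim.pr1 W.pr1
        · cases hs
          exact .inr (hpair _ _ rfl)
    | @app s t hs ht ih =>
        intro v hv
        rcases hv.app_inv_of_sat (hs.sat hsat) with ⟨s', h, rfl⟩ | ⟨t', h, rfl⟩ | ⟨c, rfl, rfl⟩ |
          ⟨rfl, rfl⟩
        · exact (ih _ h).imp (fun h => h.app ht) (fun h => h.app ht)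
        · exact .inl (hs.app (ht.step h))
        · cases hs
          exact absurd rfl (hlam c)
        · exact .inl hs
  have key : ∀ s, SN s → Elim N s → ∀ t, SN t → SN (.app s t) := by
    intro s hs
    induction hs with
    | intro s hs ihs =>
      intro he t ht
      induction ht with
      | intro t ht iht =>
        refine .of_steps fun v hv => ?_
        rcases hv.app_inv_of_sat (he.sat hsat) with ⟨s', h, rfl⟩ | ⟨t', h, rfl⟩ | ⟨c, rfl, rfl⟩ |
          ⟨rfl, rfl⟩
        · rcases inv _ he _ h with he' | hw
          · exact ihs _ h he' t (Acc.intro _ ht)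
          · exact (hw.app (Acc.intro _ ht)).sn
        · exact iht _ h
        · cases he
          exact absurd rfl (hlam c)
        · exact Acc.intro _ hs
  intro s hs
  induction hs with
  | refl => exact hNsn
  | pr1 _ ih => exact ih.pr1
  | app he ht ih => exact key _ ih he _ ht

theorem sat_of_head {N : GTerm} (h : ∀ P i, N.spineHead ≠ .nt P i) : Sat N :=
  fun P i hP => absurd hP (h P i)

theorem not_stp_of_head {N v : GTerm} (h : ∀ P i, N.spineHead ≠ .nt P i) (P : PProof) (i : ℕ)
    (args : List GTerm) (hu : N = GTerm.apps (.nt P i) args) (_ : v ∈ prods P.2 i args) : False :=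
  h P i (hu ▸ GTerm.spineHead_apps P i args)

theorem W.unit : W .unit := by
  refine .of_steps (sat_of_head (by simp [GTerm.spineHead])) (by simp) (by simp) fun v hv => ?_
  cases hv with
  | prod P i args hu hl hv =>
      exact (not_stp_of_head (by simp [GTerm.spineHead]) P i args hu hv).elim

theorem W.pair {a b : GTerm} (ha : SN a) (hb : W b) : W (.pair a b) := by
  induction ha generalizing b with
  | intro a ha iha =>
    have hbs := hb.sn
    induction hbs with
    | intro b hb' ihb =>
      refine .of_steps (sat_of_head (by simp [GTerm.spineHead])) (by simp) ?_ fun v hv => ?_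
      · rintro _ _ ⟨⟩; exact hb
      · rcases hv.pair_inv with ⟨a', h, rfl⟩ | ⟨b', h, rfl⟩
        · exact iha _ h hb
        · exact ihb _ h (hb.step h)

theorem W.esub {a b : GTerm} (α : ℕ) (ha : SN a) (hb : SN b) : W (.esub a α b) := by
  induction ha generalizing b with
  | intro a ha iha =>
    induction hb with
    | intro b hb ihb =>
      refine .of_steps (sat_of_head (by simp [GTerm.spineHead])) (by simp) (by simp)
        fun v hv => ?_
      rcases hv.esub_inv with ⟨a', h, rfl⟩ | ⟨b', h, rfl⟩
      · exact iha _ h (Acc.intro _ hb)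
      · exact ihb _ h

/-- The reducibility predicate for functions of `n` ground arguments. -/
def Arg : ℕ → GTerm → Prop
  | 0, z => W z
  | n + 1, z => ∀ t, SN t → Arg n (.app z t)

theorem W.arg {z : GTerm} (h : W z) : ∀ n, Arg n z := by
  intro n
  induction n generalizing z with
  | zero => exact h
  | succ n ih => exact fun t ht => ih (h.app ht)

theorem Arg.sn {n : ℕ} {z : GTerm} (h : Arg n z) : SN z := by
  induction n generalizing z with
  | zero => exact W.sn h
  | succ n ih => exact SN.of_map (fun x => .app x .unit) (fun h => .appL _ h) (ih (h _ W.unit.sn))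

theorem Arg.step {n : ℕ} {z z' : GTerm} (h : Arg n z) (hz : Stp z z') : Arg n z' := by
  induction n generalizing z z' with
  | zero => exact W.step h hz
  | succ n ih => exact fun t ht => ih (h t ht) (.appL t hz)

theorem Arg.of_steps {n : ℕ} {s t : GTerm} (hsat : Sat (.app s t))
    (hN : ∀ N', Stp (.app s t) N' → Arg n N') : Arg n (.app s t) := by
  induction n generalizing s t with
  | zero => exact W.of_steps hsat (by simp) (by simp) hN
  | succ n ih =>
    intro r hr
    induction hr with
    | intro r hr ihr =>
      refine ih (hsat.app r) fun v hv => ?_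
      rcases hv.app_inv_of_sat hsat with ⟨s', h, rfl⟩ | ⟨t', h, rfl⟩ | ⟨c, h, -⟩ | ⟨h, -⟩
      · exact hN _ h r (Acc.intro _ hr)
      · exact ihr _ h
      · cases h
      · cases h

/-! ### Substitution lemmas for de Bruijn terms -/

namespace GTerm

theorem shift_zero (k : ℕ) (s : GTerm) : shift 0 k s = s := by
  induction s generalizing k <;> simp_all [shift]

theorem shift_shift (j d : ℕ) (u : GTerm) (c e : ℕ) (h : c ≤ d) :
    shift j (c + e) (shift d e u) = shift (d + j) e u := by
  induction u generalizing e with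
  | bvar n =>
      simp only [shift]
      split_ifs <;> simp only [shift] <;> split_ifs <;> first | omega | rfl | (congr 1; omega)
  | lam s ih => simpa [shift, Nat.add_assoc] using ih (e + 1)
  | _ => simp_all [shift]

theorem instB_shift_cancel (t : GTerm) (j d : ℕ) (y : GTerm) (c : ℕ) (h₁ : c ≤ j)
    (h₂ : j ≤ c + d) : instB t j (shift (d + 1) c y) = shift d c y := by
  induction y generalizing c j with
  | bvar n =>
      simp only [shift]
      split_ifs <;> simp only [instB] <;> split_ifs <;> first | omega | rfl
  | lam s ih =>
      simp only [shift, instB]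
      rw [ih (j + 1) (c + 1) (by omega) (by omega)]
  | _ => simp_all [shift, instB]

theorem instB_shift (u : GTerm) (k j : ℕ) (t : GTerm) (c : ℕ) :
    instB u (c + k + j) (shift j c t) = shift j c (instB u (c + k) t) := by
  induction t generalizing c with
  | bvar n =>
      simp only [shift, instB]
      split_ifs <;> simp only [instB, shift] <;> split_ifs <;>
        first
        | omega
        | rfl
        | (congr 1; omega)
        | (have := shift_shift j (c + k) u c 0 (by omega)
           simpa using this.symm)
  | lam s ih =>
      simp only [shift, instB]
      have := ih (c + 1)
      rw [show c + 1 + k = c + k + 1 by omega, show c + k + 1 + j = c + k + j + 1 by omega] at this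
      rw [this]
  | _ => simp_all [shift, instB]

theorem instB_instB (u t : GTerm) (k : ℕ) (s : GTerm) (j : ℕ) :
    instB u (j + k) (instB t j s) = instB (instB u k t) j (instB u (j + k + 1) s) := by
  induction s generalizing j with
  | bvar n =>
      rcases lt_trichotomy n j with h | rfl | h
      · simp [instB, show n ≠ j by omega, show ¬ j < n by omega, show n ≠ j + k by omega,
          show ¬ j + k < n by omega, show n ≠ j + k + 1 by omega, show ¬ j + k + 1 < n by omega]
      · have := instB_shift u k n t 0
        simp only [Nat.zero_add] at this
        simp only [instB, if_true, show n ≠ n + k + 1 by omega, show ¬ n + k + 1 < n by omega,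
          if_false]
        rw [← this, Nat.add_comm]
      · rcases lt_trichotomy n (j + k + 1) with h' | rfl | h'
        · simp [instB, show n ≠ j by omega, h, show n ≠ j + k + 1 by omega,
            show ¬ j + k + 1 < n by omega, show n - 1 ≠ j + k by omega,
            show ¬ j + k < n - 1 by omega]
        · have := instB_shift_cancel (instB u k t) j (j + k) u 0 (by omega) (by omega)
          simp only [instB, if_true, show j + k + 1 ≠ j by omega, h, if_false,
            Nat.add_sub_cancel, this]
        · simp [instB, show n ≠ j by omega, h, show n ≠ j + k + 1 by omega, h',
            show n - 1 ≠ j + k by omega, show j + k < n - 1 by omega, show n - 1 ≠ j by omega,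
            show j < n - 1 by omega]
  | lam s ih =>
      simp only [instB]
      have := ih (j + 1)
      rw [show j + 1 + k = j + k + 1 by omega] at this
      rw [this]
  | _ => simp_all [instB]

theorem instB_apps (u : GTerm) (k : ℕ) (h : GTerm) (l : List GTerm) :
    instB u k (apps h l) = apps (instB u k h) (l.map (instB u k)) := by
  induction l using List.reverseRecOn with
  | nil => rfl
  | append_singleton l t ih => simp [apps_concat, instB, ih]

theorem instB_lams (u : GTerm) (n : ℕ) (k : ℕ) (b : GTerm) :
    instB u k (lams n b) = lams n (instB u (k + n) b) := by
  induction n generalizing k with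
  | zero => rfl
  | succ n ih =>
      simp only [lams, instB]
      rw [ih, show k + 1 + n = k + (n + 1) by omega]

theorem instB_toG (u : GTerm) (k : ℕ) (t : Term) : instB u k t.toG = t.toG := by
  induction t <;> simp_all [Term.toG, instB]

theorem instB_constSeq (u : GTerm) (k n : ℕ) : instB u k (constSeq n) = constSeq n := by
  unfold constSeq
  induction List.range n <;> simp_all [instB]

theorem instB_varSeq (u : GTerm) (k n : ℕ) : instB u (k + n) (varSeq n) = varSeq n := by
  have key : ∀ l : List ℕ, (∀ j ∈ l, j < n) →
      instB u (k + n) (l.foldr (fun j acc => .pair (.bvar j) acc) .unit) =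
        l.foldr (fun j acc => .pair (.bvar j) acc) .unit := by
    intro l hl
    induction l with
    | nil => rfl
    | cons a l ih =>
        have := hl a (by simp)
        simp only [List.foldr_cons, instB, show a ≠ k + n by omega, show ¬ k + n < a by omega,
          if_false]
        rw [ih fun j hj => hl j (by simp [hj])]
  exact key _ (by simp)

theorem instB_shift_map (u : GTerm) (k n : ℕ) (l : List GTerm) :
    (l.map (shift n 0)).map (instB u (k + n)) = (l.map (instB u k)).map (shift n 0) := by
  simp only [List.map_map]
  refine List.map_congr_left fun a _ => ?_
  have := instB_shift u k n a 0
  simpa using this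

end GTerm

theorem instB_comp (u : GTerm) (k : ℕ) (F : Formula) {Γ Δ : Sequent} (p : LK Γ) (q : LK Δ)
    (xs ys : List GTerm) :
    GTerm.instB u k (comp F ⟨_, p⟩ ⟨_, q⟩ xs ys) =
      comp F ⟨_, p⟩ ⟨_, q⟩ (xs.map (GTerm.instB u k)) (ys.map (GTerm.instB u k)) := by
  unfold comp
  split_ifs
  · rfl
  · simp only [GTerm.instB_lams, GTerm.instB_apps, List.map_cons, GTerm.instB_varSeq,
      GTerm.instB_shift_map, GTerm.instB]
  · simp only [GTerm.instB_lams, GTerm.instB_apps, List.map_cons, GTerm.instB_varSeq,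
      GTerm.instB_shift_map, GTerm.instB]

theorem prods_instB (u : GTerm) (k : ℕ) {Γ : Sequent} (p : LK Γ) (i : ℕ) (args : List GTerm) :
    prods p i (args.map (GTerm.instB u k)) = (prods p i args).map (GTerm.instB u k) := by
  have hd : ∀ n, (args.map (GTerm.instB u k)).getD n .unit =
      GTerm.instB u k (args.getD n .unit) := fun n => by
    simp only [List.getD_eq_getElem?_getD, List.getElem?_map]
    cases args[n]? <;> rfl
  cases p <;>
    simp only [prods, hd, List.map_cons, List.map_nil, GTerm.instB_apps, GTerm.instB, instB_comp,
      GTerm.instB_toG, GTerm.instB_constSeq, List.map_take, List.map_drop, List.map_tail,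
      List.map_append]

theorem Stp.instB {s s' : GTerm} (h : Stp s s') (u : GTerm) (k : ℕ) :
    Stp (GTerm.instB u k s) (GTerm.instB u k s') := by
  induction h generalizing k with
  | beta s t =>
      have := GTerm.instB_instB u t k s 0
      simp only [Nat.zero_add] at this
      rw [this]
      exact .beta _ _
  | unitApp t => exact .unitApp _
  | proj0 s t => exact .proj0 _ _
  | proj1 s t => exact .proj1 _ _
  | appL t _ ih => exact .appL _ (ih k)
  | appR s _ ih => exact .appR _ (ih k)
  | lamC _ ih => exact .lamC (ih _)
  | pairL t _ ih => exact .pairL _ (ih k)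
  | pairR s _ ih => exact .pairR _ (ih k)
  | esubL α t _ ih => exact .esubL _ _ (ih k)
  | esubR s α _ ih => exact .esubR _ _ (ih k)
  | pr0C _ ih => exact .pr0C (ih k)
  | pr1C _ ih => exact .pr1C (ih k)
  | prod P i args hu hlen hv =>
      refine .prod P i (args.map (GTerm.instB u k)) ?_ (by simpa using hlen) ?_
      · rw [hu, GTerm.instB_apps]; rfl
      · rw [prods_instB]; exact List.mem_map_of_mem hv

/-! ### Abstractions and sequence-terms are reducible -/

theorem Arg.lam {n : ℕ} {c : GTerm} (h : ∀ t, SN t → Arg n (GTerm.instB t 0 c)) :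
    Arg (n + 1) (.lam c) := by
  have hc : SN c := SN.of_map (GTerm.instB .unit 0) (fun h => h.instB _ _) (h _ W.unit.sn).sn
  induction hc with
  | intro c hc ihc =>
    intro t ht
    induction ht with
    | intro t ht iht =>
      refine .of_steps (sat_of_head (by simp [GTerm.spineHead])) fun v hv => ?_
      rcases hv.app_inv_of_sat (sat_of_head (by simp [GTerm.spineHead])) with
        ⟨s', hs, rfl⟩ | ⟨t', hs, rfl⟩ | ⟨c', hs, rfl⟩ | ⟨hs, -⟩
      · obtain ⟨c', hc', rfl⟩ := hs.lam_inv
        exact ihc c' hc' (fun t ht => (h t ht).step (hc'.instB _ _)) t (Acc.intro _ ht)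
      · exact iht _ hs
      · cases hs
        exact h t (Acc.intro _ ht)
      · cases hs

/-- Successive instantiation of the bound variables `ts.length - 1, …, 0`. -/
def instAll : List GTerm → GTerm → GTerm
  | [], b => b
  | t :: ts, b => instAll ts (GTerm.instB t ts.length b)

theorem Arg.lams {n : ℕ} {b : GTerm}
    (h : ∀ ts : List GTerm, ts.length = n → (∀ t ∈ ts, SN t) → W (instAll ts b)) :
    Arg n (GTerm.lams n b) := by
  induction n generalizing b with
  | zero => exact h [] rfl (by simp)
  | succ n ih =>
    refine Arg.lam fun t ht => ?_
    rw [GTerm.instB_lams, Nat.zero_add]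
    refine ih fun ts hl hts => ?_
    subst hl
    exact h (t :: ts) rfl (by simpa using ⟨ht, hts⟩)

theorem instAll_nt (ts : List GTerm) (P : PProof) (i : ℕ) : instAll ts (.nt P i) = .nt P i := by
  induction ts with
  | nil => rfl
  | cons t ts ih => exact ih

theorem instAll_unit (ts : List GTerm) : instAll ts .unit = .unit := by
  induction ts with
  | nil => rfl
  | cons t ts ih => exact ih

theorem instAll_pair (ts : List GTerm) (a b : GTerm) :
    instAll ts (.pair a b) = .pair (instAll ts a) (instAll ts b) := by
  induction ts generalizing a b with
  | nil => rfl
  | cons t ts ih => exact ih _ _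

theorem instAll_apps (ts : List GTerm) (h : GTerm) (l : List GTerm) :
    instAll ts (GTerm.apps h l) = GTerm.apps (instAll ts h) (l.map (instAll ts)) := by
  induction ts generalizing h l with
  | nil => simp [instAll]
  | cons t ts ih => simp [instAll, GTerm.instB_apps, ih, Function.comp_def]

theorem instAll_shift (ts : List GTerm) (y : GTerm) :
    instAll ts (GTerm.shift ts.length 0 y) = y := by
  induction ts with
  | nil => exact GTerm.shift_zero 0 y
  | cons t ts ih =>
      rw [instAll, List.length_cons,
        GTerm.instB_shift_cancel t ts.length ts.length y 0 (by omega) (by omega), ih]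

theorem sn_bvar (m : ℕ) : SN (.bvar m) := by
  refine .of_steps fun v hv => ?_
  cases hv with
  | prod P i args hu hl hv =>
      exact (not_stp_of_head (by simp [GTerm.spineHead]) P i args hu hv).elim

theorem sn_instAll_bvar (ts : List GTerm) (hts : ∀ t ∈ ts, SN t) (m : ℕ) :
    SN (instAll ts (.bvar m)) := by
  induction ts generalizing m with
  | nil => exact sn_bvar m
  | cons t ts ih =>
      have ih := ih fun t ht => hts t (by simp [ht])
      simp only [instAll, GTerm.instB]
      split_ifs
      · rw [instAll_shift]; exact hts t (by simp)
      · exact ih _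
      · exact ih _

theorem W.instAll_varSeq (ts : List GTerm) (hts : ∀ t ∈ ts, SN t) (n : ℕ) :
    W (instAll ts (GTerm.varSeq n)) := by
  unfold GTerm.varSeq
  induction (List.range n).reverse with
  | nil => simpa [instAll_unit] using W.unit
  | cons j l ih =>
      rw [List.foldr_cons, instAll_pair]
      exact W.pair (sn_instAll_bvar ts hts j) ih

theorem sn_toG (t : Term) : SN t.toG ∧ Sat t.toG ∧ (∀ v, ¬ Stp t.toG v) := by
  induction t with
  | var n =>
      have : ∀ v, ¬ Stp (Term.var n).toG v := fun v hv => by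
        cases hv with
        | prod P i args hu hl hv =>
            exact not_stp_of_head (by simp [Term.toG, GTerm.spineHead]) P i args hu hv
      exact ⟨.of_steps fun v hv => (this v hv).elim,
        sat_of_head (by simp [Term.toG, GTerm.spineHead]), this⟩
  | fn n =>
      have : ∀ v, ¬ Stp (Term.fn n).toG v := fun v hv => by
        cases hv with
        | prod P i args hu hl hv =>
            exact not_stp_of_head (by simp [Term.toG, GTerm.spineHead]) P i args hu hv
      exact ⟨.of_steps fun v hv => (this v hv).elim,
        sat_of_head (by simp [Term.toG, GTerm.spineHead]), this⟩
  | app s t ihs iht =>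
      have : ∀ v, ¬ Stp (Term.app s t).toG v := fun v hv => by
        rcases Stp.app_inv_of_sat hv ihs.2.1 with
          ⟨s', h, rfl⟩ | ⟨t', h, rfl⟩ | ⟨c, h, -⟩ | ⟨h, -⟩
        · exact ihs.2.2 _ h
        · exact iht.2.2 _ h
        · cases s <;> cases h
        · cases s <;> cases h
      exact ⟨.of_steps fun v hv => (this v hv).elim, ihs.2.1.app _, this⟩

theorem W.constSeq (n : ℕ) : W (GTerm.constSeq n) := by
  unfold GTerm.constSeq
  induction List.range n with
  | nil => exact W.unit
  | cons j l ih => exact W.pair (sn_toG (.fn 0)).1 ih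

/-! ### Non-terminals are reducible -/

/-- One-step rewriting in one component of a list. -/
inductive ListStp : List GTerm → List GTerm → Prop
  | head {a a' : GTerm} (l : List GTerm) : Stp a a' → ListStp (a :: l) (a' :: l)
  | tail (a : GTerm) {l l' : List GTerm} : ListStp l l' → ListStp (a :: l) (a :: l')

theorem ListStp.append_right {l l' : List GTerm} (h : ListStp l l') (r : List GTerm) :
    ListStp (l ++ r) (l' ++ r) := by
  induction h with
  | head l h => exact .head _ h
  | tail a _ ih => exact .tail a ih

theorem ListStp.concat (l : List GTerm) {a a' : GTerm} (h : Stp a a') :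
    ListStp (l ++ [a]) (l ++ [a']) := by
  induction l with
  | nil => exact .head _ h
  | cons b l ih => exact .tail b ih

theorem acc_listStp {l : List GTerm} (h : ∀ a ∈ l, SN a) : Acc (fun b a => ListStp a b) l := by
  induction l with
  | nil => exact Acc.intro _ fun _ h => nomatch h
  | cons a l ih =>
    have hl := ih fun b hb => h b (by simp [hb])
    have ha : SN a := h a (by simp)
    clear ih h
    induction ha generalizing l with
    | intro a ha iha =>
      induction hl with
      | intro l hl ihl =>
        refine Acc.intro _ fun r hr => ?_
        cases hr with
        | head _ h => exact iha _ h _ (Acc.intro _ hl)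
        | tail _ h => exact ihl _ h

theorem Stp.nt_inv {P : PProof} {i : ℕ} {args : List GTerm} {v : GTerm}
    (h : Stp (GTerm.apps (.nt P i) args) v) (hl : args.length ≤ P.1.length) :
    (∃ args', ListStp args args' ∧ v = GTerm.apps (.nt P i) args') ∨
      (args.length = P.1.length ∧ v ∈ prods P.2 i args) := by
  induction args using List.reverseRecOn generalizing v with
  | nil =>
      cases h with
      | prod P' i' args' hu hl' hv =>
          have h₁ := congrArg GTerm.spineArgs hu
          have h₂ := congrArg GTerm.spineHead hu
          rw [GTerm.spineArgs_apps, GTerm.spineArgs_apps] at h₁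
          rw [GTerm.spineHead_apps, GTerm.spineHead_apps] at h₂
          cases h₂
          obtain rfl : args' = [] := h₁.symm
          exact .inr ⟨hl', hv⟩
  | append_singleton l t ih =>
      rw [GTerm.apps_concat] at h
      simp only [List.length_append, List.length_singleton] at hl
      rcases h.app_inv with ⟨s', h', rfl⟩ | ⟨t', h', rfl⟩ | ⟨c, h', -⟩ | ⟨h', -⟩ |
        ⟨P', i', args', hl', hs, hv⟩
      · rcases ih h' (by omega) with ⟨l', hl', rfl⟩ | ⟨h, -⟩
        · exact .inl ⟨l' ++ [t], hl'.append_right _, (GTerm.apps_concat ..).symm⟩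
        · omega
      · exact .inl ⟨l ++ [t'], .concat l h', (GTerm.apps_concat ..).symm⟩
      · have := congrArg GTerm.spineHead h'
        rw [GTerm.spineHead_apps] at this
        cases this
      · have := congrArg GTerm.spineHead h'
        rw [GTerm.spineHead_apps] at this
        cases this
      · have h₁ := congrArg GTerm.spineArgs hs
        have h₂ := congrArg GTerm.spineHead hs
        rw [GTerm.spineArgs_apps, GTerm.spineArgs_apps] at h₁
        rw [GTerm.spineHead_apps, GTerm.spineHead_apps] at h₂
        cases h₂
        subst h₁
        exact .inr ⟨by simpa using hl', hv⟩

/-- The arguments `args` are reducible of the types given by the sequent `Γ`. -/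
def GoodArgs (Γ : Sequent) (args : List GTerm) : Prop :=
  List.Forall₂ (fun F z => Arg F.exPre z) Γ args

theorem GoodArgs.sn {Γ : Sequent} {args : List GTerm} (h : GoodArgs Γ args) :
    ∀ a ∈ args, SN a := by
  induction h with
  | nil => simp
  | cons h _ ih => simpa using ⟨h.sn, ih⟩

theorem GoodArgs.step {Γ : Sequent} {args args' : List GTerm} (h : GoodArgs Γ args)
    (hs : ListStp args args') : GoodArgs Γ args' := by
  induction h generalizing args' with
  | nil => cases hs
  | cons h hr ih =>
    cases hs with
    | head _ hs => exact .cons (h.step hs) hr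
    | tail _ hs => exact .cons h (ih hs)

theorem GoodArgs.append {Γ Δ : Sequent} {xs ys : List GTerm} (h : GoodArgs Γ xs)
    (h' : GoodArgs Δ ys) : GoodArgs (Γ ++ Δ) (xs ++ ys) := by
  induction h with
  | nil => exact h'
  | cons h _ ih => exact .cons h ih

theorem GoodArgs.split {Γ Δ : Sequent} {args : List GTerm} (h : GoodArgs (Γ ++ Δ) args) :
    ∃ xs ys, args = xs ++ ys ∧ GoodArgs Γ xs ∧ GoodArgs Δ ys := by
  induction Γ generalizing args with
  | nil => exact ⟨[], args, rfl, .nil, h⟩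
  | cons A Γ ih =>
    cases h with
    | cons h hr =>
      obtain ⟨xs, ys, rfl, hx, hy⟩ := ih hr
      exact ⟨_ :: xs, ys, rfl, .cons h hx, hy⟩

/-- The non-terminals of the last sequent of the proof are reducible. -/
def NtGood {Γ : Sequent} (p : LK Γ) : Prop :=
  ∀ i args, GoodArgs Γ args → W (GTerm.apps (.nt ⟨Γ, p⟩ i) args)

theorem W.of_nt {P : PProof} {i : ℕ} {args : List GTerm} (hl : args.length = P.1.length)
    (h : ∀ v, Stp (GTerm.apps (.nt P i) args) v → W v) : W (GTerm.apps (.nt P i) args) := by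
  refine .of_steps ?_ ?_ ?_ h
  · intro Q j hQ
    rw [GTerm.spineHead_apps] at hQ
    cases hQ
    rw [GTerm.spineArgs_apps, hl]
  · intro c hc
    have := GTerm.spineHead_apps P i args
    rw [hc] at this
    cases this
  · intro a b hc
    have := GTerm.spineHead_apps P i args
    rw [hc] at this
    cases this

theorem NtGood.of_prods {Γ : Sequent} {p : LK Γ}
    (h : ∀ i args, GoodArgs Γ args → ∀ v ∈ prods p i args, W v) : NtGood p := by
  intro i args hg
  have hacc := acc_listStp hg.sn
  induction hacc with
  | intro args _ ih =>
    have hl : args.length = Γ.length := hg.length_eq.symm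
    refine .of_nt hl fun v hv => ?_
    rcases hv.nt_inv hl.le with ⟨args', hs, rfl⟩ | ⟨-, hv⟩
    · exact ih _ hs (hg.step hs)
    · exact h i args hg v hv

theorem exPre_subst (v : ℕ) (t : Term) (A : Formula) : (A.subst v t).exPre = A.exPre := by
  induction A with
  | ex w A ih => simp only [Formula.subst]; split_ifs <;> simp [Formula.exPre, ih]
  | all w A ih => simp only [Formula.subst]; split_ifs <;> rfl
  | _ => rfl

theorem dual_dual (A : Formula) : A.dual.dual = A := by
  induction A <;> simp_all [Formula.dual]

theorem allPre_eq_exPre_dual (A : Formula) : A.allPre = A.dual.exPre := by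
  induction A with
  | all w A ih => simp [Formula.dual, Formula.exPre, Formula.allPre, ih]
  | _ => rfl

theorem Arg.lams_nt {P : PProof} {xs : List GTerm}
    (h : ∀ z, W z → W (GTerm.apps (.nt P 0) (z :: xs))) (n : ℕ) :
    Arg n (.lams n (GTerm.apps (.nt P 0) (GTerm.varSeq n :: xs.map (GTerm.shift n 0)))) := by
  refine Arg.lams fun ts hl hts => ?_
  subst hl
  have : (xs.map (GTerm.shift ts.length 0)).map (instAll ts) = xs := by
    simp [Function.comp_def, instAll_shift]
  rw [instAll_apps, instAll_nt, List.map_cons, this]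
  exact h _ (W.instAll_varSeq ts hts _)

theorem Arg.comp {Γ Δ : Sequent} {F G : Formula} {p : LK (F :: Γ)} {q : LK (G :: Δ)}
    (hFG : G = F.dual) (hp : NtGood p) (hq : NtGood q) {xs ys : List GTerm}
    (hx : GoodArgs Γ xs) (hy : GoodArgs Δ ys) :
    Arg G.exPre (comp F ⟨_, p⟩ ⟨_, q⟩ xs ys) := by
  subst hFG
  unfold PGram.comp
  split_ifs
  · exact W.unit.arg _
  · rw [allPre_eq_exPre_dual]
    exact Arg.lams_nt (fun z hz => hp 0 _ (.cons (hz.arg _) hx)) _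
  · exact (hp 0 _ (.cons (Arg.lams_nt (fun z hz => hq 0 _ (.cons (hz.arg _) hy)) _) hx)).arg _

theorem ntGood {Γ : Sequent} (p : LK Γ) : NtGood p := by
  induction p with
  | ax b P ts =>
      refine .of_prods fun i args hg v hv => ?_
      rcases hg with _ | ⟨h₀, _ | ⟨h₁, _ | _⟩⟩
      simp only [prods, List.getD_cons_zero, List.getD_cons_succ, List.mem_cons,
        List.not_mem_nil, or_false] at hv
      rcases hv with rfl | rfl
      · exact h₁
      · exact h₀
  | orI A B Γ p ih =>
      refine .of_prods fun i args hg v hv => ?_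
      rcases hg with _ | ⟨h, hr⟩
      simp only [prods, List.tail_cons, List.mem_cons, List.not_mem_nil, or_false] at hv
      rcases hv with rfl | rfl
      · exact W.unit
      · exact ih _ _ (.cons (W.unit.arg _) (.cons (W.unit.arg _) hr))
  | andI A B Γ Δ p q ihp ihq =>
      refine .of_prods fun i args hg v hv => ?_
      rcases hg with _ | ⟨h, hr⟩
      obtain ⟨xs, ys, rfl, hx, hy⟩ := GoodArgs.split hr
      simp only [prods, List.tail_cons, hx.length_eq, List.take_left, List.drop_left,
        List.mem_cons, List.not_mem_nil, or_false] at hv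
      rcases hv with rfl | rfl | rfl
      · exact W.unit
      · exact ihp _ _ (.cons (W.unit.arg _) hx)
      · exact ihq _ _ (.cons (W.unit.arg _) hy)
  | allI v α A Γ p ih =>
      refine .of_prods fun i args hg w hw => ?_
      rcases hg with _ | ⟨h, hr⟩
      simp only [prods, List.tail_cons, List.getD_cons_zero, List.mem_singleton] at hw
      subst hw
      have h : W _ := h
      exact W.esub α (ih _ _ (.cons (h.pr1.arg _) hr)).sn h.sn.pr0
  | exI v t A Γ p ih =>
      refine .of_prods fun i args hg w hw => ?_
      rcases hg with _ | ⟨h, hr⟩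
      simp only [prods, List.tail_cons, List.getD_cons_zero, List.mem_cons, List.not_mem_nil,
        or_false] at hw
      have h' := ih i _ (.cons (by rw [exPre_subst]; exact h t.toG (sn_toG t).1) hr)
      rcases hw with rfl | rfl
      · exact W.pair (sn_toG t).1 h'
      · exact h'
  | cut A Γ Δ p q ihp ihq =>
      refine .of_prods fun i args hg v hv => ?_
      obtain ⟨xs, ys, rfl, hx, hy⟩ := GoodArgs.split hg
      simp only [prods, hx.length_eq, List.take_left, List.drop_left, List.mem_cons,
        List.not_mem_nil, or_false] at hv
      rcases hv with rfl | rfl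
      · exact ihp _ _ (.cons (Arg.comp (dual_dual A).symm ihq ihp hy hx) hx)
      · exact ihq _ _ (.cons (Arg.comp rfl ihp ihq hx hy) hy)
  | wk A Γ p ih =>
      refine .of_prods fun i args hg v hv => ?_
      rcases hg with _ | ⟨h, hr⟩
      simp only [prods, List.tail_cons, List.mem_cons, List.not_mem_nil, or_false] at hv
      rcases hv with rfl | rfl
      · exact W.constSeq _
      · exact ih _ _ hr
  | ctr A Γ p ih =>
      refine .of_prods fun i args hg v hv => ?_
      rcases hg with _ | ⟨h, hr⟩
      simp only [prods, List.tail_cons, List.getD_cons_zero, List.mem_cons, List.not_mem_nil,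
        or_false] at hv
      rcases hv with rfl | rfl
      · exact ih _ _ (.cons h (.cons h hr))
      · exact ih _ _ (.cons h (.cons h hr))
  | perm A B Γ Δ p ih =>
      refine .of_prods fun i args hg v hv => ?_
      obtain ⟨xs, ys, rfl, hx, hy⟩ := GoodArgs.split hg
      rcases hy with _ | ⟨h₀, _ | ⟨h₁, hr⟩⟩
      simp only [prods, hx.length_eq, List.take_left, List.mem_singleton] at hv
      simp only [List.getD_eq_getElem?_getD, List.drop_append,
        List.drop_of_length_le (show xs.length ≤ xs.length + 2 by omega)] at hv
      simp at hv
      subst hv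
      exact ih _ _ (hx.append (.cons h₁ (.cons h₀ hr)))

theorem sn_startTerm (p : PProof) (i : ℕ) : SN (startTerm p i) := by
  refine (ntGood p.2 i _ ?_).sn
  induction p.1 with
  | nil => exact .nil
  | cons A Γ ih => exact .cons (W.unit.arg _) ih

/-! ### Finiteness of the set of derivable terms -/

theorem finite_root (u : GTerm) :
    {v | ∃ P i args, u = GTerm.apps (.nt P i) args ∧ v ∈ prods P.2 i args}.Finite := by
  by_cases h : ∃ P i args, u = GTerm.apps (.nt P i) args
  · obtain ⟨P, i, args, rfl⟩ := h
    refine (List.finite_toSet (prods P.2 i args)).subset ?_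
    rintro v ⟨P', i', args', hu, hv⟩
    have h₁ := congrArg GTerm.spineArgs hu
    have h₂ := congrArg GTerm.spineHead hu
    rw [GTerm.spineArgs_apps, GTerm.spineArgs_apps] at h₁
    rw [GTerm.spineHead_apps, GTerm.spineHead_apps] at h₂
    cases h₂
    subst h₁
    exact hv
  · refine Set.finite_empty.subset ?_
    rintro v ⟨P, i, args, hu, -⟩
    exact h ⟨P, i, args, hu⟩

theorem finite_stp_of_root {u : GTerm}
    (h : ∀ v, Stp u v → ∃ P i args, u = GTerm.apps (.nt P i) args ∧ v ∈ prods P.2 i args) :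
    {v | Stp u v}.Finite :=
  (finite_root u).subset h

theorem finite_stp (u : GTerm) : {v | Stp u v}.Finite := by
  induction u with
  | app s t ihs iht =>
      refine (((ihs.image (GTerm.app · t)).union (iht.image (GTerm.app s ·))).union
        ((finite_root (.app s t)).union
          (Set.toFinite {GTerm.unit, GTerm.instB t 0 (match s with | .lam c => c | c => c)}))).subset
        fun v hv => ?_
      cases hv with
      | beta => simp
      | unitApp => simp
      | appL _ h => exact .inl (.inl ⟨_, h, rfl⟩)
      | appR _ h => exact .inl (.inr ⟨_, h, rfl⟩)
      | prod P i args hu _ hv => exact .inr (.inl ⟨P, i, args, hu, hv⟩)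
  | lam s ih =>
      refine (ih.image GTerm.lam).subset fun v hv => ?_
      obtain ⟨a, ha, rfl⟩ := hv.lam_inv
      exact ⟨_, ha, rfl⟩
  | pair s t ihs iht =>
      refine ((ihs.image (GTerm.pair · t)).union (iht.image (GTerm.pair s ·))).subset
        fun v hv => ?_
      rcases hv.pair_inv with ⟨a, ha, rfl⟩ | ⟨a, ha, rfl⟩
      · exact .inl ⟨_, ha, rfl⟩
      · exact .inr ⟨_, ha, rfl⟩
  | esub s α t ihs iht =>
      refine ((ihs.image (GTerm.esub · α t)).union (iht.image (GTerm.esub s α ·))).subset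
        fun v hv => ?_
      rcases hv.esub_inv with ⟨a, ha, rfl⟩ | ⟨a, ha, rfl⟩
      · exact .inl ⟨_, ha, rfl⟩
      · exact .inr ⟨_, ha, rfl⟩
  | pr0 s ih =>
      refine ((ih.image GTerm.pr0).union
        (Set.finite_singleton (match s with | .pair a _ => a | c => c))).subset fun v hv => ?_
      rcases hv.pr0_inv with ⟨a, ha, rfl⟩ | ⟨b, rfl⟩
      · exact .inl ⟨_, ha, rfl⟩
      · exact .inr rfl
  | pr1 s ih =>
      refine ((ih.image GTerm.pr1).union
        (Set.finite_singleton (match s with | .pair _ b => b | c => c))).subset fun v hv => ?_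
      rcases hv.pr1_inv with ⟨a, ha, rfl⟩ | ⟨b, rfl⟩
      · exact .inl ⟨_, ha, rfl⟩
      · exact .inr rfl
  | _ =>
      refine finite_stp_of_root fun v hv => ?_
      cases hv with
      | prod P i args hu _ hv => exact ⟨P, i, args, hu, hv⟩

theorem SN.finite_reach {u : GTerm} (h : SN u) : {v | Relation.ReflTransGen Stp u v}.Finite := by
  induction h with
  | intro u _ ih =>
    refine ((Set.finite_singleton u).union ((finite_stp u).biUnion ih)).subset fun v hv => ?_
    rcases Relation.ReflTransGen.cases_head hv with rfl | ⟨w, hw, hwv⟩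
    · exact .inl rfl
    · exact .inr (Set.mem_biUnion hw hwv)

theorem reach_toStp {u v : GTerm} (h : Relation.ReflTransGen (Step true) u v) :
    Relation.ReflTransGen Stp u v :=
  h.lift id fun _ _ h => h.toStp

theorem finite_langP (p : PProof) : (LangP true p).Finite := by
  refine ((Set.finite_Iio p.1.length).biUnion fun i _ =>
    ((sn_startTerm p i).finite_reach.image
      fun T => (i, T.evalE.toSeq.getD []))).subset ?_
  rintro ⟨i, l⟩ ⟨hi, T, ⟨hT, -⟩, hl⟩
  refine Set.mem_biUnion (Set.mem_Iio.mpr hi) ⟨T, reach_toStp hT, ?_⟩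
  have hl : T.evalE.toSeq = some l := hl
  simp [hl]

/-! ### Simulation of the context-sensitive rule -/

theorem Step.simulate {u v : GTerm} (h : Step false u v) :
    Relation.ReflTransGen (Step true) u v := by
  induction h with
  | appL t _ ih => exact ih.lift (GTerm.app · t) fun _ _ h => .appL t h
  | appR s _ ih => exact ih.lift (GTerm.app s ·) fun _ _ h => .appR s h
  | lamC _ ih => exact ih.lift GTerm.lam fun _ _ h => .lamC h
  | pairL t _ ih => exact ih.lift (GTerm.pair · t) fun _ _ h => .pairL t h
  | pairR s _ ih => exact ih.lift (GTerm.pair s ·) fun _ _ h => .pairR s h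
  | esubL α t _ ih => exact ih.lift (GTerm.esub · α t) fun _ _ h => .esubL α t h
  | esubR s α _ ih => exact ih.lift (GTerm.esub s α ·) fun _ _ h => .esubR s α h
  | pr0C _ ih => exact ih.lift GTerm.pr0 fun _ _ h => .pr0C h
  | pr1C _ ih => exact ih.lift GTerm.pr1 fun _ _ h => .pr1C h
  | @allP v α A Γ p i z₀ z₁ ys hy _ =>
      have apps : ∀ (l : List GTerm) {a b : GTerm}, Step true a b →
          Step true (GTerm.apps a l) (GTerm.apps b l) := by
        intro l
        induction l with
        | nil => exact fun h => h
        | cons c l ih => exact fun h => ih (.appL c h)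
      exact ((Relation.ReflTransGen.single (Step.allPcf p i _ ys hy rfl)).tail
        (.esubL _ _ (apps ys (.appR _ (.proj1 z₀ z₁))))).tail (.esubR _ _ (.proj0 z₀ z₁))
  | allPcf _ _ _ _ _ hcf => cases hcf
  | beta s t => exact .single (.beta s t)
  | unitApp t => exact .single (.unitApp t)
  | proj0 s t => exact .single (.proj0 s t)
  | proj1 s t => exact .single (.proj1 s t)
  | ax0 b P ts z₀ z₁ => exact .single (.ax0 b P ts z₀ z₁)
  | ax1 b P ts z₀ z₁ => exact .single (.ax1 b P ts z₀ z₁)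
  | orI0 p z ys hy => exact .single (.orI0 p z ys hy)
  | orIS p i z ys hy => exact .single (.orIS p i z ys hy)
  | andI0 p q z xs ys hx hy => exact .single (.andI0 p q z xs ys hx hy)
  | andIL p q i z xs ys hx hy hi => exact .single (.andIL p q i z xs ys hx hy hi)
  | andIR p q i z xs ys hx hy hi => exact .single (.andIR p q i z xs ys hx hy hi)
  | exI0 p z ys hy => exact .single (.exI0 p z ys hy)
  | exIS p i z ys hy => exact .single (.exIS p i z ys hy)
  | cutL p q i xs ys hx hy hi => exact .single (.cutL p q i xs ys hx hy hi)
  | cutR p q i xs ys hx hy hi => exact .single (.cutR p q i xs ys hx hy hi)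
  | ctr0a p z ys hy => exact .single (.ctr0a p z ys hy)
  | ctr0b p z ys hy => exact .single (.ctr0b p z ys hy)
  | ctrS p i z ys hy => exact .single (.ctrS p i z ys hy)
  | wk0 p z ys hy => exact .single (.wk0 p z ys hy)
  | wkS p i z ys hy => exact .single (.wkS p i z ys hy)
  | permP p i xs z₀ z₁ ys hx hy => exact .single (.permP p i xs z₀ z₁ ys hx hy)

/-! ### Invariance of evaluated first-order terms -/

/-- Terms built from variables, function symbols, `⟨⟩`, pairing and application, without
applications of `⟨⟩`. -/
def FirstOrder : GTerm → Prop
  | .fvar _ => True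
  | .fn _ => True
  | .unit => True
  | .app s t => s ≠ .unit ∧ FirstOrder s ∧ FirstOrder t
  | .pair s t => FirstOrder s ∧ FirstOrder t
  | _ => False

theorem firstOrder_of_toFOT {s : GTerm} {t : Term} (h : s.toFOT = some t) :
    FirstOrder s ∧ s ≠ .unit := by
  induction s generalizing t with
  | app a b iha ihb =>
      simp only [GTerm.toFOT, Option.pure_def, Option.bind_eq_bind, Option.bind_eq_some_iff] at h
      obtain ⟨a', ha, b', hb, -⟩ := h
      exact ⟨⟨(iha ha).2, (iha ha).1, (ihb hb).1⟩, by simp⟩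
  | _ => simp_all [GTerm.toFOT, FirstOrder]

theorem firstOrder_of_toSeq {s : GTerm} {l : List Term} (h : s.toSeq = some l) :
    FirstOrder s := by
  induction s generalizing l with
  | pair a b iha ihb =>
      simp only [GTerm.toSeq, Option.pure_def, Option.bind_eq_bind, Option.bind_eq_some_iff] at h
      obtain ⟨a', ha, b', hb, -⟩ := h
      exact ⟨(firstOrder_of_toFOT ha).1, ihb hb⟩
  | _ => simp_all [GTerm.toSeq, FirstOrder]

theorem FirstOrder.of_substF {α : ℕ} {u s : GTerm} (h : FirstOrder (GTerm.substF α u s)) :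
    FirstOrder s ∧ (FirstOrder u ∨ ∀ u', GTerm.substF α u' s = s) := by
  induction s with
  | fvar n =>
      simp only [GTerm.substF] at h ⊢
      split_ifs at h ⊢ with hn
      · exact ⟨trivial, .inl h⟩
      · exact ⟨trivial, .inr fun _ => rfl⟩
  | fn n => exact ⟨trivial, .inr fun _ => rfl⟩
  | unit => exact ⟨trivial, .inr fun _ => rfl⟩
  | app a b iha ihb =>
      obtain ⟨h₀, h₁, h₂⟩ := h
      obtain ⟨ha, ha'⟩ := iha h₁
      obtain ⟨hb, hb'⟩ := ihb h₂
      refine ⟨⟨?_, ha, hb⟩, ?_⟩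
      · rintro rfl; exact h₀ rfl
      · rcases ha' with ha' | ha'
        · exact .inl ha'
        · exact hb'.imp_right fun hb' u' => by simp [GTerm.substF, ha', hb']
  | pair a b iha ihb =>
      obtain ⟨h₁, h₂⟩ := h
      obtain ⟨ha, ha'⟩ := iha h₁
      obtain ⟨hb, hb'⟩ := ihb h₂
      refine ⟨⟨ha, hb⟩, ?_⟩
      rcases ha' with ha' | ha'
      · exact .inl ha'
      · exact hb'.imp_right fun hb' u' => by simp [GTerm.substF, ha', hb']
  | _ => exact h.elim

theorem not_firstOrder_apps_nt (P : PProof) (i : ℕ) (l : List GTerm) :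
    ¬ FirstOrder (GTerm.apps (.nt P i) l).evalE := by
  induction l using List.reverseRecOn with
  | nil => exact id
  | append_singleton l t ih =>
      rw [GTerm.apps_concat]
      exact fun h => ih h.2.1

theorem Stp.evalE_eq {u v : GTerm} (h : Stp u v) (hu : FirstOrder u.evalE) :
    v.evalE = u.evalE := by
  induction h with
  | beta s t => exact hu.2.1.elim
  | unitApp t => exact absurd rfl hu.1
  | proj0 s t => exact hu.elim
  | proj1 s t => exact hu.elim
  | appL t _ ih => simp only [GTerm.evalE]; rw [ih hu.2.1]
  | appR s _ ih => simp only [GTerm.evalE]; rw [ih hu.2.2]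
  | lamC _ ih => exact hu.elim
  | pairL t _ ih => simp only [GTerm.evalE]; rw [ih hu.1]
  | pairR s _ ih => simp only [GTerm.evalE]; rw [ih hu.2]
  | esubL α t _ ih => simp only [GTerm.evalE]; rw [ih (FirstOrder.of_substF hu).1]
  | esubR s α _ ih =>
      simp only [GTerm.evalE]
      rcases (FirstOrder.of_substF hu).2 with h | h
      · rw [ih h]
      · rw [h, h]
  | pr0C _ ih => exact hu.elim
  | pr1C _ ih => exact hu.elim
  | prod P i args hu' => subst hu'; exact (not_firstOrder_apps_nt _ _ _ hu).elim

theorem SN.exists_normalForm {u : GTerm} (h : SN u) (hu : FirstOrder u.evalE) :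
    ∃ v, Relation.ReflTransGen (Step true) u v ∧ NormalForm true v ∧ v.evalE = u.evalE := by
  induction h with
  | intro u _ ih =>
    by_cases hn : NormalForm true u
    · exact ⟨u, .refl, hn, rfl⟩
    · simp only [NormalForm, not_forall, not_not] at hn
      obtain ⟨w, hw⟩ := hn
      have he := hw.toStp.evalE_eq hu
      obtain ⟨v, hwv, hv, hev⟩ := ih w hw.toStp (he ▸ hu)
      exact ⟨v, .head hw hwv, hv, hev.trans he⟩

theorem langP_subset (p : PProof) : LangP false p ⊆ LangP true p := by
  rintro x ⟨hi, T, ⟨hT, -⟩, hl⟩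
  have hT' : Relation.ReflTransGen (Step true) (startTerm p x.1) T := by
    clear hl
    induction hT with
    | refl => exact .refl
    | tail _ h ih => exact ih.trans h.simulate
  have hsn : SN T := by
    have hr := reach_toStp hT'
    clear hT hT' hl
    induction hr with
    | refl => exact sn_startTerm p x.1
    | tail _ h ih => exact ih.step h
  obtain ⟨v, hv, hn, he⟩ := hsn.exists_normalForm (firstOrder_of_toSeq hl)
  exact ⟨hi, v, ⟨hT'.trans hv, hn⟩, he ▸ hl⟩

end PGram

open PGram in
/-- **Section 3.2.** Replacing the context-sensitive `∀` production rule by the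
context-free rule via pair projections yields a grammar whose language
contains `L(G_π)` and is still finite. -/
theorem contextfree_variant {Γ : Sequent} (π : LK Γ) (hreg : π.Regular)
    (hΓ : ∀ A ∈ Γ, Sigma1 A) (hcuts : π.CutsPi2Sigma2) :
    L ⟨_, π⟩ ⊆ L' ⟨_, π⟩ ∧ (L' ⟨_, π⟩).Finite := by
  exact ⟨langP_subset _, finite_langP _⟩
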